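/- arXiv:2401.14623 — 6 statements merged into one kernel-verified Lean document; each statement's English description precedes it below -/
import Mathlib

section
/- Let F ∈ {0,1}^{X×Y} be a Boolean matrix on finite sets X, Y whose 1-entries can be covered by c ≥ 1 rectangles S₁×T₁, …, S_c×T_c on each of which F is identically 1 (i.e., F(x,y) = 1 implies (x,y) ∈ S_i×T_i for some i, and F ≡ 1 on each S_i×T_i). Then for every pair of probability measures μ_X on X and μ_Y on Y, there exists a rectangle S×T ⊆ X×Y on which F is constant and which satisfies μ_X(S)·μ_Y(T) ≥ 1/(4c²). -/
open scoped BigOperators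

/-- A union bound for nonnegative weights. -/
theorem sum_biUnion_le_sum_sum {X ι : Type*} [DecidableEq X] (w : X → ℝ) (hw0 : ∀ x, 0 ≤ w x)
    (I : Finset ι) (S : ι → Finset X) :
    ∑ x ∈ I.biUnion S, w x ≤ ∑ i ∈ I, ∑ x ∈ S i, w x := by
  classical
  induction I using Finset.induction_on with
  | empty => simp
  | insert i I hi ih =>
    rw [Finset.biUnion_insert, Finset.sum_insert hi]
    have hinter := Finset.sum_union_inter (s₁ := S i) (s₂ := I.biUnion S) (f := w)
    have hnonneg : 0 ≤ ∑ x ∈ S i ∩ I.biUnion S, w x := Finset.sum_nonneg fun x _ => hw0 x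
    linarith

/-- If finitely many sets indexed by `I` each have weight at most `1 / (2c)`, where `#I ≤ c`,
then the complement of their union has weight at least `1 / 2` under a probability weight. -/
theorem half_le_sum_compl_biUnion {X ι : Type*} [Fintype X] [DecidableEq X]
    (w : X → ℝ) (hw0 : ∀ x, 0 ≤ w x) (hw1 : ∑ x, w x = 1) {c : ℕ} (hc : 1 ≤ c)
    (I : Finset ι) (hI : I.card ≤ c) (S : ι → Finset X)
    (hS : ∀ i ∈ I, ∑ x ∈ S i, w x ≤ 1 / (2 * (c : ℝ))) :
    1 / 2 ≤ ∑ x ∈ (I.biUnion S)ᶜ, w x := by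
  have hc0 : (0 : ℝ) < c := by exact_mod_cast hc
  have hunion : ∑ x ∈ I.biUnion S, w x ≤ 1 / 2 :=
    calc ∑ x ∈ I.biUnion S, w x ≤ ∑ i ∈ I, ∑ x ∈ S i, w x :=
          sum_biUnion_le_sum_sum w hw0 I S
      _ ≤ I.card • (1 / (2 * (c : ℝ))) := Finset.sum_le_card_nsmul _ _ _ hS
      _ ≤ c * (1 / (2 * (c : ℝ))) := by
          rw [nsmul_eq_mul]
          gcongr
      _ = 1 / 2 := by field_simp
  have hsplit := Finset.sum_add_sum_compl (I.biUnion S) w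
  linarith

/-- If the 1-entries of a Boolean matrix `F` can be covered by `c ≥ 1`
1-monochromatic rectangles, then for every pair of probability measures on the rows
and columns there is a monochromatic rectangle of weight at least `1/(4c²)`. -/
theorem exists_heavy_monochromatic_rectangle_of_cover {X Y : Type*} [Fintype X] [Fintype Y]
    (F : Matrix X Y ℝ) (h01 : ∀ x y, F x y = 0 ∨ F x y = 1)
    (c : ℕ) (hc : 1 ≤ c)
    (S : Fin c → Finset X) (T : Fin c → Finset Y)
    (hcover : ∀ x y, F x y = 1 → ∃ i, x ∈ S i ∧ y ∈ T i)
    (hmono : ∀ i, ∀ x ∈ S i, ∀ y ∈ T i, F x y = 1)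
    (μX : X → ℝ) (hμX0 : ∀ x, 0 ≤ μX x) (hμX1 : ∑ x, μX x = 1)
    (μY : Y → ℝ) (hμY0 : ∀ y, 0 ≤ μY y) (hμY1 : ∑ y, μY y = 1) :
    ∃ (S' : Finset X) (T' : Finset Y) (b : ℝ),
      (∀ x ∈ S', ∀ y ∈ T', F x y = b) ∧
      1 / (4 * (c : ℝ) ^ 2) ≤ (∑ x ∈ S', μX x) * (∑ y ∈ T', μY y) := by
  classical
  have hc1 : (1 : ℝ) ≤ c := by exact_mod_cast hc
  by_cases hbig : ∃ i, 1 / (2 * (c : ℝ)) ≤ ∑ x ∈ S i, μX x ∧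
      1 / (2 * (c : ℝ)) ≤ ∑ y ∈ T i, μY y
  · obtain ⟨i, hX, hY⟩ := hbig
    refine ⟨S i, T i, 1, hmono i, ?_⟩
    calc 1 / (4 * (c : ℝ) ^ 2) = 1 / (2 * (c : ℝ)) * (1 / (2 * (c : ℝ))) := by
          field_simp
          norm_num
      _ ≤ _ := mul_le_mul hX hY (by positivity) (Finset.sum_nonneg fun x _ => hμX0 x)
  · push Not at hbig
    set I : Finset (Fin c) := {i | ∑ x ∈ S i, μX x < 1 / (2 * (c : ℝ))} with hI
    have hcard (J : Finset (Fin c)) : J.card ≤ c := by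
      simpa using J.card_le_univ
    have hX := half_le_sum_compl_biUnion μX hμX0 hμX1 hc I (hcard I) S fun i hi =>
      (Finset.mem_filter.mp hi).2.le
    have hY := half_le_sum_compl_biUnion μY hμY0 hμY1 hc Iᶜ (hcard Iᶜ) T fun i hi =>
      (hbig i (by simpa [hI] using hi)).le
    refine ⟨(I.biUnion S)ᶜ, (Iᶜ.biUnion T)ᶜ, 0, fun x hx y hy => ?_, ?_⟩
    · refine (h01 x y).resolve_right fun h => ?_
      obtain ⟨i, hxi, hyi⟩ := hcover x y h
      by_cases hi : i ∈ I
      · exact Finset.mem_compl.mp hx (Finset.mem_biUnion.mpr ⟨i, hi, hxi⟩)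
      · exact Finset.mem_compl.mp hy
          (Finset.mem_biUnion.mpr ⟨i, Finset.mem_compl.mpr hi, hyi⟩)
    · calc 1 / (4 * (c : ℝ) ^ 2) ≤ 1 / (4 * 1 ^ 2) := by gcongr
        _ = 1 / 2 * (1 / 2) := by norm_num
        _ ≤ _ := mul_le_mul hX hY (by positivity) (Finset.sum_nonneg fun x _ => hμX0 x)
end

section
/- Let X, Y be finite sets, a : X → ℤ and b : Y → ℤ functions, and let Π₁, Π₂, A ∈ {−1,1}^{X×Y} be sign matrices such that A(x,y) = Π₁(x,y) whenever a(x) = b(y) and A(x,y) = Π₂(x,y) whenever a(x) ≠ b(y). Then rank_±(A) ≤ rank_±(Π₁) + 3·rank_±(Π₂). -/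
open scoped BigOperators

/-- The sign-rank of a sign matrix `F`: the smallest rank of a real matrix `M` with
`F x y * M x y > 0` for all entries. -/
noncomputable def signRank {X Y : Type*} [Fintype X] [Fintype Y] (F : Matrix X Y ℝ) : ℕ :=
  sInf {r : ℕ | ∃ M : Matrix X Y ℝ, (∀ x y, 0 < F x y * M x y) ∧ M.rank ≤ r}

/-- The sign-rank is attained by some sign-representing matrix. -/
theorem exists_rank_le_signRank {X Y : Type*} [Fintype X] [Fintype Y] (F : Matrix X Y ℝ)
    (hF : ∀ x y, F x y = 1 ∨ F x y = -1) :
    ∃ M : Matrix X Y ℝ, (∀ x y, 0 < F x y * M x y) ∧ M.rank ≤ signRank F := by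
  refine Nat.sInf_mem
    (s := {r : ℕ | ∃ M : Matrix X Y ℝ, (∀ x y, 0 < F x y * M x y) ∧ M.rank ≤ r})
    ⟨F.rank, F, fun x y => ?_, le_rfl⟩
  rcases hF x y with h | h <;> simp [h]

/-- Scaling the rows and columns of a matrix does not increase its rank. -/
theorem rank_scale_le {X Y : Type*} [Fintype X] [Fintype Y] (u : X → ℝ) (v : Y → ℝ)
    (M : Matrix X Y ℝ) : (Matrix.of fun x y => u x * M x y * v y).rank ≤ M.rank := by
  classical
  have h : (Matrix.of fun x y => u x * M x y * v y) =
      Matrix.diagonal u * M * Matrix.diagonal v := by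
    ext x y
    simp
  rw [h]
  exact (Matrix.rank_mul_le_left _ _).trans (Matrix.rank_mul_le_right _ _)

/-- The rank of a sum of matrices is at most the sum of the ranks. -/
theorem rank_add_le_rank_add_rank {X Y : Type*} [Fintype X] [Fintype Y] (M N : Matrix X Y ℝ) :
    (M + N).rank ≤ M.rank + N.rank := by
  rw [Matrix.rank, Matrix.rank, Matrix.rank, Matrix.mulVecLin_add]
  exact (Submodule.finrank_mono (LinearMap.range_add_le _ _)).trans
    (Submodule.finrank_add_le_finrank_add_finrank _ _)

/-- If a sign matrix `A` agrees with `P₁` on entries where `a x = b y` and with `P₂`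
on entries where `a x ≠ b y`, then `rank_±(A) ≤ rank_±(P₁) + 3·rank_±(P₂)`. -/
theorem signRank_of_equality_split {X Y : Type*} [Fintype X] [Fintype Y]
    (a : X → ℤ) (b : Y → ℤ) (P₁ P₂ A : Matrix X Y ℝ)
    (hP₁ : ∀ x y, P₁ x y = 1 ∨ P₁ x y = -1)
    (hP₂ : ∀ x y, P₂ x y = 1 ∨ P₂ x y = -1)
    (hA : ∀ x y, A x y = 1 ∨ A x y = -1)
    (heq : ∀ x y, a x = b y → A x y = P₁ x y)
    (hne : ∀ x y, a x ≠ b y → A x y = P₂ x y) :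
    signRank A ≤ signRank P₁ + 3 * signRank P₂ := by
  obtain ⟨M₁, hM₁, hr₁⟩ := exists_rank_le_signRank P₁ hP₁
  obtain ⟨M₂, hM₂, hr₂⟩ := exists_rank_le_signRank P₂ hP₂
  obtain ⟨C, hC⟩ := Finite.exists_le
    fun p : X × Y => (|M₁ p.1 p.2| + 1) / (P₂ p.1 p.2 * M₂ p.1 p.2)
  let N₁ : Matrix X Y ℝ := Matrix.of fun x y => (C * (a x : ℝ) ^ 2) * M₂ x y * 1
  let N₂ : Matrix X Y ℝ := Matrix.of fun x y => (-2 * C * (a x : ℝ)) * M₂ x y * (b y : ℝ)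
  let N₃ : Matrix X Y ℝ := Matrix.of fun x y => C * M₂ x y * (b y : ℝ) ^ 2
  have hN₁ : N₁.rank ≤ M₂.rank := rank_scale_le _ (fun _ => 1) M₂
  have hN₂ : N₂.rank ≤ M₂.rank :=
    rank_scale_le (fun x => -2 * C * (a x : ℝ)) (fun y => (b y : ℝ)) M₂
  have hN₃ : N₃.rank ≤ M₂.rank := rank_scale_le (fun _ => C) (fun y => (b y : ℝ) ^ 2) M₂
  refine Nat.sInf_le ⟨M₁ + N₁ + N₂ + N₃, fun x y => ?_, ?_⟩
  · have hentry : (M₁ + N₁ + N₂ + N₃) x y =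
        M₁ x y + C * ((a x : ℝ) - b y) ^ 2 * M₂ x y := by
      simp only [N₁, N₂, N₃, Matrix.add_apply, Matrix.of_apply]
      ring
    rw [hentry]
    by_cases h : a x = b y
    · simpa [h, heq x y h] using hM₁ x y
    · rw [hne x y h]
      have hpos := hM₂ x y
      have hCt : |M₁ x y| + 1 ≤ C * (P₂ x y * M₂ x y) := (div_le_iff₀ hpos).1 (hC (x, y))
      have hd : (1 : ℝ) ≤ ((a x : ℝ) - b y) ^ 2 := by
        have : 0 < (a x - b y) ^ 2 := sq_pos_of_ne_zero (sub_ne_zero.2 h)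
        exact_mod_cast this
      have habs : -|M₁ x y| ≤ P₂ x y * M₁ x y := by
        rcases hP₂ x y with h' | h' <;> rw [h']
        · simpa using neg_abs_le (M₁ x y)
        · simpa using le_abs_self (M₁ x y)
      have hmul := le_mul_of_one_le_left
        ((by positivity : 0 ≤ |M₁ x y| + 1).trans hCt) hd
      linarith
  · have h₁ := rank_add_le_rank_add_rank M₁ N₁
    have h₂ := rank_add_le_rank_add_rank (M₁ + N₁) N₂
    have h₃ := rank_add_le_rank_add_rank (M₁ + N₁ + N₂) N₃
    omega
end

section
/- (Quantitative Cohen's theorem for ℤ₂ⁿ, Green–Sanders) For every c > 0 there exists a positive integer L = ℓ(c), depending only on c, such that for every n ≥ 1 and every subset S ⊆ 𝔽₂ⁿ with ‖1_S‖_A ≤ c, there exist an integer L' ≤ L, signs ε₁, …, ε_{L'} ∈ {−1, +1}, and cosets C₁, …, C_{L'} of (additive) subgroups of 𝔽₂ⁿ such that 1_S = Σ_{i=1}^{L'} ε_i · 1_{C_i} as functions 𝔽₂ⁿ → ℝ. -/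
open scoped BigOperators

/-- The character `χ_S(x) = (-1)^{⟨S,x⟩}` on `𝔽₂ⁿ`. -/
noncomputable def chi {n : ℕ} (S x : Fin n → ZMod 2) : ℝ :=
  if (∑ i, S i * x i) = 0 then 1 else -1

/-- The Fourier coefficient `f̂(S) = 2^{-n} ∑_x f(x) (-1)^{⟨S,x⟩}`. -/
noncomputable def fCoeff {n : ℕ} (f : (Fin n → ZMod 2) → ℝ) (S : Fin n → ZMod 2) : ℝ :=
  (2 ^ n : ℝ)⁻¹ * ∑ x : Fin n → ZMod 2, f x * chi S x

/-- The Fourier algebra (spectral) norm `‖f‖_A = ∑_S |f̂(S)|`. -/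
noncomputable def algebraNorm {n : ℕ} (f : (Fin n → ZMod 2) → ℝ) : ℝ :=
  ∑ S : Fin n → ZMod 2, |fCoeff f S|

section Rounding

open Finset

/-- Finite Ramsey theorem for subsets of a fixed size. -/
theorem exists_ramsey (κ : Type) [Fintype κ] (j : ℕ) : ∀ m : ℕ, ∃ N : ℕ,
    ∀ (g : Finset ℕ → κ) (S : Finset ℕ), N ≤ #S →
      ∃ T ⊆ S, #T = m ∧ ∃ c : κ, ∀ J ⊆ T, #J = j → g J = c := by
  classical
  induction j with
  | zero =>
    refine fun m => ⟨m, fun g S hS => ?_⟩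
    obtain ⟨T, hT, hm⟩ := exists_subset_card_eq hS
    refine ⟨T, hT, hm, g ∅, fun J _ hJ => ?_⟩
    rw [card_eq_zero.1 hJ]
  | succ j ih =>
    have key : ∀ l : ℕ, ∃ N : ℕ, ∀ (g : Finset ℕ → κ) (S : Finset ℕ), N ≤ #S →
        ∃ T ⊆ S, #T = l ∧ ∃ c : ℕ → κ, ∀ a ∈ T, ∀ J ⊆ T, (∀ b ∈ J, a < b) → #J = j →
          g (insert a J) = c a := by
      intro l
      induction l with
      | zero =>
        refine ⟨1, fun g S hS => ⟨∅, empty_subset _, rfl, fun _ => g ∅, ?_⟩⟩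
        simp
      | succ l ihl =>
        obtain ⟨N₁, h₁⟩ := ihl
        obtain ⟨N₂, h₂⟩ := ih N₁
        refine ⟨N₂ + 1, fun g S hS => ?_⟩
        have hne : S.Nonempty := card_pos.1 (by omega)
        set a := S.min' hne with ha
        have haS : a ∈ S := min'_mem _ _
        obtain ⟨S', hS', hcard, col, hcol⟩ := h₂ (fun J => g (insert a J)) (S.erase a)
          (by rw [card_erase_of_mem haS]; omega)
        obtain ⟨T, hT, hTl, c, hc⟩ := h₁ g S' hcard.ge
        have hlt : ∀ b ∈ T, a < b := fun b hb => by
          have := hS' (hT hb)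
          rw [mem_erase] at this
          exact lt_of_le_of_ne (min'_le _ _ this.2) (Ne.symm this.1)
        have haT : a ∉ T := fun h => lt_irrefl _ (hlt a h)
        refine ⟨insert a T, ?_, by rw [card_insert_of_notMem haT, hTl],
          fun x => if x = a then col else c x, ?_⟩
        · exact insert_subset haS (hT.trans (hS'.trans (erase_subset _ _)))
        · intro x hx J hJ hxJ hJj
          have hJT : J ⊆ T := fun b hb => by
            rcases mem_insert.1 (hJ hb) with h | h
            · exfalso
              have h1 := hxJ b hb
              rcases mem_insert.1 hx with h2 | h2
              · omega
              · have := hlt x h2; omega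
            · exact h
          rcases mem_insert.1 hx with h | h
          · subst h
            simpa using hcol J (hJT.trans hT) hJj
          · have hxa : x ≠ a := fun h' => haT (h' ▸ h)
            simpa [hxa] using hc x h J hJT hxJ hJj
    intro m
    obtain ⟨N, hN⟩ := key (Fintype.card κ * m + 1)
    refine ⟨N, fun g S hS => ?_⟩
    obtain ⟨T, hT, hTl, c, hc⟩ := hN g S hS
    obtain ⟨y, -, hy⟩ := exists_lt_card_fiber_of_mul_lt_card_of_maps_to (s := T)
      (t := (univ : Finset κ)) (f := c) (n := m) (fun a _ => mem_univ _)
      (by rw [hTl, card_univ]; omega)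
    obtain ⟨T', hT', hm⟩ := exists_subset_card_eq hy.le
    refine ⟨T', hT'.trans ((filter_subset _ _).trans hT), hm, y, fun J hJ hJj => ?_⟩
    have hne : J.Nonempty := card_pos.1 (by omega)
    have hmem : J.min' hne ∈ J := min'_mem _ _
    have hJT : J ⊆ T := hJ.trans (hT'.trans (filter_subset _ _))
    rw [← insert_erase hmem, hc _ (hJT hmem) _ ((erase_subset _ _).trans hJT)]
    · exact (mem_filter.1 (hT' (hJ hmem))).2
    · intro b hb
      rw [mem_erase] at hb
      exact lt_of_le_of_ne (min'_le _ _ hb.2) (Ne.symm hb.1)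
    · rw [card_erase_of_mem hmem]; omega

/-- Finite Ramsey theorem, simultaneously for all subsets of size at most `k`. -/
theorem exists_ramsey_le (κ : Type) [Fintype κ] (k : ℕ) : ∀ m : ℕ, ∃ N : ℕ,
    ∀ (g : Finset ℕ → κ) (S : Finset ℕ), N ≤ #S →
      ∃ T ⊆ S, #T = m ∧ ∃ c : ℕ → κ, ∀ J ⊆ T, #J ≤ k → g J = c #J := by
  induction k with
  | zero =>
    refine fun m => ⟨m, fun g S hS => ?_⟩
    obtain ⟨T, hT, hm⟩ := exists_subset_card_eq hS
    refine ⟨T, hT, hm, fun _ => g ∅, fun J _ hJ => ?_⟩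
    rw [card_eq_zero.1 (Nat.le_zero.1 hJ)]
  | succ k ih =>
    intro m
    obtain ⟨N₁, h₁⟩ := ih m
    obtain ⟨N₂, h₂⟩ := exists_ramsey κ (k + 1) N₁
    refine ⟨N₂, fun g S hS => ?_⟩
    obtain ⟨T₂, hT₂, hc₂, col, hcol⟩ := h₂ g S hS
    obtain ⟨T₁, hT₁, hc₁, c, hc⟩ := h₁ g T₂ hc₂.ge
    refine ⟨T₁, hT₁.trans hT₂, hc₁, fun i => if i = k + 1 then col else c i, fun J hJ hJk => ?_⟩
    by_cases h : #J = k + 1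
    · simpa [h] using hcol J (hJ.trans hT₁) h
    · simpa [h] using hc J hJ (by omega)

/-- A bounded integer sequence whose iterated differences of some order vanish on a long
interval is constant there. -/
theorem exists_forall_eq_of_fwdDiff_iter_eq_zero (r : ℕ) : ∀ B : ℕ, ∃ K₀ : ℕ, ∀ K ≥ K₀,
    ∀ h : ℕ → ℤ, (∀ i ≤ K + r, |h i| ≤ B) → (∀ a ≤ K, (fwdDiff 1)^[r] h a = 0) →
      ∀ i ≤ K, h i = h 0 := by
  induction r with
  | zero =>
    intro B
    refine ⟨0, fun K _ h _ h0 i hi => ?_⟩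
    have h1 := h0 i hi
    have h2 := h0 0 (Nat.zero_le _)
    simp only [Function.iterate_zero, id] at h1 h2
    rw [h1, h2]
  | succ r ih =>
    intro B
    obtain ⟨K₀, hK₀⟩ := ih (2 * B)
    refine ⟨max K₀ (2 * B + 1), fun K hK h hB h0 => ?_⟩
    have hd : ∀ i ≤ K, fwdDiff 1 h i = fwdDiff 1 h 0 := by
      refine hK₀ K (le_trans (le_max_left _ _) hK) (fwdDiff 1 h) (fun i hi => ?_) (fun a ha => ?_)
      · have h1 := abs_le.1 (hB i (by omega))
        have h2 := abs_le.1 (hB (i + 1) (by omega))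
        simp only [fwdDiff]
        rw [abs_le]
        push_cast
        constructor <;> linarith [h1.1, h1.2, h2.1, h2.2]
      · have := h0 a ha
        rwa [Function.iterate_succ_apply] at this
    have hlin : ∀ i ≤ K, h i = h 0 + i * fwdDiff 1 h 0 := by
      intro i
      induction i with
      | zero => simp
      | succ i ihi =>
        intro hi
        have h1 := ihi (by omega)
        have h2 := hd i (by omega)
        have h3 : fwdDiff 1 h i = h (i + 1) - h i := rfl
        push_cast
        linarith
    have hzero : fwdDiff 1 h 0 = 0 := by
      by_contra hne
      have h1 := hlin K le_rfl
      have hb0 := abs_le.1 (hB 0 (by omega))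
      have hbK := abs_le.1 (hB K (by omega))
      have hKB : (2 * B + 1 : ℤ) ≤ K := by exact_mod_cast le_trans (le_max_right _ _) hK
      have h2 : (K : ℤ) * fwdDiff 1 h 0 = h K - h 0 := by linarith
      have h3 : |(K : ℤ) * fwdDiff 1 h 0| ≤ 2 * B := by
        rw [h2, abs_le]; constructor <;> linarith [hb0.1, hb0.2, hbK.1, hbK.2]
      rw [abs_mul, Nat.abs_cast] at h3
      have h4 : 1 ≤ |fwdDiff 1 h 0| := Int.one_le_abs hne
      nlinarith
    intro i hi
    rw [hlin i hi, hzero]; simp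

/-- `|t| (1 - t²)^r` is small on `[-1, 1]`. -/
theorem abs_mul_one_sub_sq_pow_le (t : ℝ) (ht : |t| ≤ 1) (r : ℕ) (δ : ℝ) (hδ : 0 < δ)
    (hr : 1 ≤ r * δ ^ 2) : |t| * (1 - t ^ 2) ^ r ≤ δ := by
  have ht2 : t ^ 2 ≤ 1 := by rw [← sq_abs]; nlinarith [abs_nonneg t]
  have h0 : 0 ≤ 1 - t ^ 2 := by linarith
  have hb := one_add_mul_le_pow (show (-2 : ℝ) ≤ t ^ 2 by nlinarith [sq_nonneg t]) r
  have hp : (1 - t ^ 2) ^ r * (1 + t ^ 2) ^ r ≤ 1 := by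
    rw [← mul_pow]
    exact pow_le_one₀ (by nlinarith [sq_nonneg t]) (by nlinarith [sq_nonneg t])
  have hp0 : 0 ≤ (1 - t ^ 2) ^ r := pow_nonneg h0 r
  have hp1 : (1 - t ^ 2) ^ r ≤ 1 := pow_le_one₀ h0 (by nlinarith [sq_nonneg t])
  set p := (1 - t ^ 2) ^ r
  have h1 : p * (1 + r * t ^ 2) ≤ 1 := le_trans (mul_le_mul_of_nonneg_left hb hp0) hp
  have h2 : (|t| * p) ^ 2 ≤ δ ^ 2 := by
    rw [mul_pow, sq_abs]
    have h3 : t ^ 2 * p ≤ δ ^ 2 := by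
      have h4 : p * (r * t ^ 2) ≤ 1 := by nlinarith
      have h5 : p * (r * t ^ 2) * δ ^ 2 ≤ δ ^ 2 := by nlinarith [sq_nonneg δ]
      have h6 : t ^ 2 * p * 1 ≤ t ^ 2 * p * (r * δ ^ 2) :=
        mul_le_mul_of_nonneg_left hr (by positivity)
      linarith
    nlinarith [mul_nonneg (sq_nonneg t) hp0]
  exact abs_le_of_sq_le_sq' h2 hδ.le |>.2

section Characters

variable {n : ℕ}

theorem chi_comm (S x : Fin n → ZMod 2) : chi S x = chi x S := by
  simp [chi, mul_comm]

theorem chi_add_right (S x y : Fin n → ZMod 2) : chi S (x + y) = chi S x * chi S y := by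
  have h : ∀ a b : ZMod 2, (if a + b = 0 then (1 : ℝ) else -1) =
      (if a = 0 then 1 else -1) * (if b = 0 then 1 else -1) := by
    intro a b
    have h2 : ∀ a : ZMod 2, a = 0 ∨ a = 1 := by decide
    have h3 : (1 + 1 : ZMod 2) = 0 := by decide
    rcases h2 a with rfl | rfl <;> rcases h2 b with rfl | rfl <;> simp [h3]
  simp only [chi, Pi.add_apply, mul_add, sum_add_distrib]
  exact h _ _

theorem chi_add_left (S T x : Fin n → ZMod 2) : chi (S + T) x = chi S x * chi T x := by
  rw [chi_comm, chi_add_right, chi_comm x, chi_comm x]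

theorem abs_chi (S x : Fin n → ZMod 2) : |chi S x| = 1 := by
  unfold chi; split_ifs <;> simp

theorem chi_zero_right (S : Fin n → ZMod 2) : chi S 0 = 1 := by simp [chi]

/-- The function on `𝔽₂ⁿ` with Fourier coefficients `c`. -/
noncomputable def fourierSum (c : (Fin n → ZMod 2) → ℝ) (x : Fin n → ZMod 2) : ℝ :=
  ∑ S, c S * chi S x

theorem abs_fourierSum_le (c : (Fin n → ZMod 2) → ℝ) (x : Fin n → ZMod 2) :
    |fourierSum c x| ≤ ∑ S, |c S| := by
  refine (abs_sum_le_sum_abs _ _).trans (sum_le_sum fun S _ => ?_)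
  rw [abs_mul, abs_chi, mul_one]

/-- Moments of the averages of the characters over points `x i`, `i ∈ T`, are close to the values
at sums of distinct points, when those values depend only on the number of summands. -/
theorem abs_moment_sub_le (c : (Fin n → ZMod 2) → ℝ) (z : (Fin n → ZMod 2) → ℤ) (B : ℝ)
    (hc : ∑ S, |c S| ≤ B) (ε : ℝ) (hz : ∀ x, |fourierSum c x - z x| ≤ ε)
    (x : ℕ → Fin n → ZMod 2) (T : Finset ℕ) (hT : T.Nonempty) (φ : ℕ → ℤ) (D : ℕ)
    (hφ : ∀ J ⊆ T, #J ≤ D → z (∑ i ∈ J, x i) = φ #J) (hφB : ∀ j ≤ D, |(φ j : ℝ)| ≤ B) :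
    ∀ b : ℕ, ∀ J ⊆ T, #J + b ≤ D →
      |∑ S, c S * ((∑ i ∈ T, chi S (x i)) / #T) ^ b * chi S (∑ i ∈ J, x i) - φ (#J + b)| ≤
        ε + b * (D * (2 * B) / #T) := by
  classical
  have hT0 : (0 : ℝ) < #T := by exact_mod_cast card_pos.2 hT
  have hB0 : 0 ≤ B := le_trans (sum_nonneg fun _ _ => abs_nonneg _) hc
  have hε : 0 ≤ ε := le_trans (abs_nonneg _) (hz 0)
  have ht : ∀ S, |(∑ i ∈ T, chi S (x i)) / #T| ≤ 1 := fun S => by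
    rw [abs_div, abs_of_pos hT0, div_le_one hT0]
    refine (abs_sum_le_sum_abs _ _).trans ?_
    simp [abs_chi]
  intro b
  induction b with
  | zero =>
    intro J hJ hJD
    have := hz (∑ i ∈ J, x i)
    rw [hφ J hJ (by omega)] at this
    simpa [fourierSum] using this
  | succ b ih =>
    intro J hJ hJD
    set t : (Fin n → ZMod 2) → ℝ := fun S => (∑ i ∈ T, chi S (x i)) / #T with htdef
    have hexp : ∑ S, c S * t S ^ (b + 1) * chi S (∑ i ∈ J, x i) - φ (#J + (b + 1)) =
        (∑ i ∈ T, (∑ S, c S * t S ^ b * chi S (x i + ∑ k ∈ J, x k) - φ (#J + (b + 1)))) / #T := by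
      rw [sum_sub_distrib, sum_const, nsmul_eq_mul, sub_div, mul_div_cancel_left₀ _ hT0.ne',
        sum_comm, sum_div]
      congr 1
      refine sum_congr rfl fun S _ => ?_
      simp only [chi_add_right]
      rw [← mul_sum, ← sum_mul, pow_succ]
      simp only [htdef]
      ring
    have hterm : ∀ i ∈ T, |∑ S, c S * t S ^ b * chi S (x i + ∑ k ∈ J, x k) - φ (#J + (b + 1))| ≤
        (ε + b * (D * (2 * B) / #T)) + if i ∈ J then 2 * B else 0 := by
      intro i hi
      split_ifs with hiJ
      · have h1 : |∑ S, c S * t S ^ b * chi S (x i + ∑ k ∈ J, x k)| ≤ B := by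
          refine (abs_sum_le_sum_abs _ _).trans (le_trans (sum_le_sum fun S _ => ?_) hc)
          rw [abs_mul, abs_mul, abs_chi, mul_one, abs_pow]
          exact mul_le_of_le_one_right (abs_nonneg _) (pow_le_one₀ (abs_nonneg _) (ht S))
        have h2 := hφB _ hJD
        have h3 := abs_sub (∑ S, c S * t S ^ b * chi S (x i + ∑ k ∈ J, x k))
          (φ (#J + (b + 1)) : ℝ)
        have h4 : 0 ≤ (b : ℝ) * (D * (2 * B) / #T) := by positivity
        linarith
      · have h1 := ih (insert i J) (insert_subset hi hJ)
          (by rw [card_insert_of_notMem hiJ]; omega)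
        rw [card_insert_of_notMem hiJ, sum_insert hiJ] at h1
        rw [add_zero, show #J + (b + 1) = #J + 1 + b by ring]
        exact h1
    rw [hexp, abs_div, abs_of_pos hT0, div_le_iff₀ hT0]
    refine (abs_sum_le_sum_abs _ _).trans ((sum_le_sum hterm).trans ?_)
    rw [sum_add_distrib, sum_const, nsmul_eq_mul, ← sum_filter, sum_const, nsmul_eq_mul]
    have h1 : (#(T.filter (· ∈ J)) : ℝ) ≤ D := by
      have : #(T.filter (· ∈ J)) ≤ #J := card_le_card fun i hi => (mem_filter.1 hi).2
      exact_mod_cast this.trans (by omega)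
    have h2 : (#(T.filter (· ∈ J)) : ℝ) * (2 * B) ≤ D * (2 * B) :=
      mul_le_mul_of_nonneg_right h1 (by linarith)
    have h3 : (D * (2 * B) / #T) * #T = D * (2 * B) := div_mul_cancel₀ _ hT0.ne'
    push_cast
    linear_combination h2 - h3

end Characters

/-- Among sufficiently many points at which an almost integer-valued function of bounded spectral
norm does not vanish, there are `K` all of whose odd sums are again such points. -/
theorem exists_forall_odd_sum_ne_zero (M : ℝ) (hM : 0 ≤ M) :
    ∃ ε : ℝ, 0 < ε ∧ ε ≤ 1 ∧ ∀ K : ℕ, ∃ m : ℕ, ∀ (n : ℕ) (c : (Fin n → ZMod 2) → ℝ)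
      (z : (Fin n → ZMod 2) → ℤ), ∑ S, |c S| ≤ M → (∀ x, |fourierSum c x - z x| ≤ ε) →
      ∀ x : ℕ → Fin n → ZMod 2, (∀ i < m, z (x i) ≠ 0) →
        ∃ I ⊆ range m, #I = K ∧ ∀ J ⊆ I, Odd #J → z (∑ i ∈ J, x i) ≠ 0 := by
  set δ : ℝ := 1 / (4 * (M + 1)) with hδ
  have hδ0 : 0 < δ := by positivity
  have hMδ : M * δ ≤ 1 / 4 := by
    rw [hδ, mul_one_div, div_le_div_iff₀ (by positivity) (by norm_num)]; linarith
  obtain ⟨r, hr⟩ := exists_nat_ge (1 / δ ^ 2)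
  rw [div_le_iff₀ (by positivity)] at hr
  have h2r : (0 : ℝ) < 2 ^ r := by positivity
  refine ⟨1 / (8 * 2 ^ r), by positivity, ?_, fun K => ?_⟩
  · rw [div_le_one (by positivity)]
    have : (1 : ℝ) ≤ 2 ^ r := one_le_pow₀ (by norm_num)
    linarith
  obtain ⟨B, hB⟩ := exists_nat_ge (M + 1)
  obtain ⟨K₀, hK₀⟩ := exists_forall_eq_of_fwdDiff_iter_eq_zero r B
  set K₁ := max K K₀
  set D := 2 * (K₁ + r) + 1 with hD
  set T₀ := 2 ^ r * (D * (D * (2 * B))) * 4 + K + D with hT₀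
  obtain ⟨m, hm⟩ := exists_ramsey_le (Set.Icc (-(B : ℤ)) B) D T₀
  refine ⟨m, fun n c z hc hz x hx => ?_⟩
  have hzB : ∀ y, |z y| ≤ B := fun y => by
    have h1 := hz y
    have h2 := (abs_fourierSum_le c y).trans hc
    have h3 : (1 : ℝ) / (8 * 2 ^ r) ≤ 1 := by
      rw [div_le_one (by positivity)]
      have : (1 : ℝ) ≤ 2 ^ r := one_le_pow₀ (by norm_num)
      linarith
    have h4 : |(z y : ℝ)| ≤ B := by
      rw [abs_le] at *
      constructor <;> linarith [h1.1, h1.2, h2.1, h2.2]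
    exact_mod_cast h4
  obtain ⟨T, hT, hTc, φ', hφ'⟩ := hm (fun J => ⟨z (∑ i ∈ J, x i), abs_le.1 (hzB _)⟩) (range m)
    (by simp)
  set φ : ℕ → ℤ := fun j => φ' j with hφdef
  have hφ : ∀ J ⊆ T, #J ≤ D → z (∑ i ∈ J, x i) = φ #J := fun J hJ hJD =>
    congrArg Subtype.val (hφ' J hJ hJD)
  have hφB : ∀ j, |φ j| ≤ B := fun j => abs_le.2 (φ' j).2
  have hTne : T.Nonempty := card_pos.1 (by omega)
  have hT0 : (0 : ℝ) < #T := by exact_mod_cast card_pos.2 hTne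
  set t : (Fin n → ZMod 2) → ℝ := fun S => (∑ i ∈ T, chi S (x i)) / #T with htdef
  have ht : ∀ S, |t S| ≤ 1 := fun S => by
    rw [htdef, abs_div, abs_of_pos hT0, div_le_one hT0]
    refine (abs_sum_le_sum_abs _ _).trans ?_
    simp [abs_chi]
  set E : ℝ := 1 / (8 * 2 ^ r) + D * (D * (2 * B) / #T) with hE
  have hE2 : 2 ^ r * E ≤ 3 / 8 := by
    have h1 : (2 : ℝ) ^ r * (D * (D * (2 * B))) * 4 ≤ #T := by
      rw [hTc]
      exact_mod_cast (by omega : 2 ^ r * (D * (D * (2 * B))) * 4 ≤ T₀)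
    have h2 : (2 : ℝ) ^ r * (D * (D * (2 * B) / #T)) ≤ 1 / 4 := by
      rw [show (2 : ℝ) ^ r * (D * (D * (2 * B) / #T)) = (2 ^ r * (D * (D * (2 * B)))) / #T by ring,
        div_le_iff₀ hT0]
      linarith
    have h3 : (2 : ℝ) ^ r * (1 / (8 * 2 ^ r)) = 1 / 8 := by field_simp
    rw [hE, mul_add]; linarith
  have hψ : ∀ b ≤ D, |∑ S, c S * t S ^ b - φ b| ≤ E := fun b hb => by
    have := abs_moment_sub_le c z B (hc.trans (by linarith)) _ hz x T hTne φ D hφ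
      (fun j _ => by exact_mod_cast hφB j) b ∅ (empty_subset _) (by simpa using hb)
    simp only [sum_empty, chi_zero_right, mul_one, card_empty, zero_add] at this
    refine this.trans ?_
    have : (b : ℝ) ≤ D := by exact_mod_cast hb
    rw [hE]
    gcongr
  have hdiff : ∀ a ≤ K₁, (fwdDiff 1)^[r] (fun i => φ (2 * i + 1)) a = 0 := by
    intro a ha
    rw [← Int.abs_lt_one_iff, fwdDiff_iter_eq_sum_shift]
    have hcast : ((∑ k ∈ range (r + 1), ((-1 : ℤ) ^ (r - k) * r.choose k) •
        φ (2 * (a + k • 1) + 1) : ℤ) : ℝ) =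
        (∑ S, c S * (t S ^ (2 * a + 1) * (t S ^ 2 + -1) ^ r)) -
        ∑ k ∈ range (r + 1), ((-1 : ℝ) ^ (r - k) * r.choose k) *
          (∑ S, c S * t S ^ (2 * (a + k) + 1) - φ (2 * (a + k) + 1)) := by
      have h1 : ∑ S, c S * (t S ^ (2 * a + 1) * (t S ^ 2 + -1) ^ r) =
          ∑ k ∈ range (r + 1), ((-1 : ℝ) ^ (r - k) * r.choose k) *
            ∑ S, c S * t S ^ (2 * (a + k) + 1) := by
        simp_rw [mul_sum]
        rw [sum_comm]
        refine sum_congr rfl fun S _ => ?_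
        rw [add_pow, mul_sum, mul_sum]
        refine sum_congr rfl fun k _ => ?_
        rw [← pow_mul, show 2 * (a + k) + 1 = 2 * a + 1 + 2 * k by ring, pow_add _ (2 * a + 1)]
        ring
      rw [h1, ← sum_sub_distrib]
      push_cast
      refine sum_congr rfl fun k _ => ?_
      simp only [smul_eq_mul, mul_one]
      push_cast
      ring
    have hb1 : |∑ S, c S * (t S ^ (2 * a + 1) * (t S ^ 2 + -1) ^ r)| ≤ M * δ := by
      refine (abs_sum_le_sum_abs _ _).trans ?_
      refine le_trans (sum_le_sum (g := fun S => |c S| * δ) fun S _ => ?_) ?_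
      · rw [abs_mul]
        refine mul_le_mul_of_nonneg_left ?_ (abs_nonneg _)
        have h2 : t S ^ 2 ≤ 1 := by
          rw [← sq_abs]; nlinarith [abs_nonneg (t S), ht S]
        have h3 := abs_mul_one_sub_sq_pow_le (t S) (ht S) r δ hδ0 hr
        have h4 : |t S ^ 2 + -1| = 1 - t S ^ 2 := by
          rw [abs_of_nonpos (by linarith)]; ring
        rw [abs_mul, abs_pow, abs_pow, h4, pow_succ, mul_assoc]
        exact (mul_le_of_le_one_left (mul_nonneg (abs_nonneg _) (pow_nonneg (by linarith) _))
          (pow_le_one₀ (abs_nonneg _) (ht S))).trans h3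
      · rw [← sum_mul]
        exact mul_le_mul_of_nonneg_right hc hδ0.le
    have hb2 : |∑ k ∈ range (r + 1), ((-1 : ℝ) ^ (r - k) * r.choose k) *
          (∑ S, c S * t S ^ (2 * (a + k) + 1) - φ (2 * (a + k) + 1))| ≤ 2 ^ r * E := by
      refine (abs_sum_le_sum_abs _ _).trans ?_
      refine le_trans (sum_le_sum (g := fun k => (r.choose k : ℝ) * E) fun k hk => ?_) ?_
      · rw [abs_mul, abs_mul, abs_pow, abs_neg, abs_one, one_pow, one_mul, Nat.abs_cast]
        have hk' := mem_range.1 hk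
        exact mul_le_mul_of_nonneg_left (hψ _ (by omega)) (Nat.cast_nonneg _)
      · rw [← sum_mul]
        refine le_of_eq ?_
        congr 1
        exact_mod_cast Nat.sum_range_choose r
    have hfin : |((∑ k ∈ range (r + 1), ((-1 : ℤ) ^ (r - k) * r.choose k) •
        φ (2 * (a + k • 1) + 1) : ℤ) : ℝ)| < 1 := by
      rw [hcast]
      refine (abs_sub _ _).trans_lt ?_
      linarith
    exact_mod_cast hfin
  have hconst := hK₀ K₁ (le_max_right _ _) (fun i => φ (2 * i + 1)) (fun i _ => hφB _) hdiff
  obtain ⟨I, hI, hIK⟩ := exists_subset_card_eq (show K ≤ #T by omega)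
  refine ⟨I, hI.trans hT, hIK, fun J hJ hodd => ?_⟩
  have hJK : #J ≤ K := hIK ▸ card_le_card hJ
  have hKK : K ≤ K₁ := le_max_left _ _
  obtain ⟨i, hi⟩ := hodd
  obtain ⟨i₀, hi₀⟩ := hTne
  have h1 := hφ {i₀} (singleton_subset_iff.2 hi₀) (by simp; omega)
  rw [sum_singleton, card_singleton] at h1
  have h2 := hconst i (by omega)
  simp only [mul_zero, zero_add] at h2
  rw [hφ J (hJ.trans hI) (by omega), hi, h2, ← h1]
  exact hx i₀ (mem_range.1 (hT hi₀))

section Subspaces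

variable {n : ℕ}

/-- The standard bilinear form on `𝔽₂ⁿ`. -/
noncomputable def dotForm (n : ℕ) : LinearMap.BilinForm (ZMod 2) (Fin n → ZMod 2) :=
  Matrix.toBilin' 1

theorem dotForm_apply (x y : Fin n → ZMod 2) : dotForm n x y = ∑ i, x i * y i := by
  simp [dotForm, Matrix.toBilin'_apply', dotProduct]

theorem dotForm_isRefl : (dotForm n).IsRefl := fun x y h => by
  rw [dotForm_apply] at *
  simpa only [mul_comm] using h

theorem dotForm_nondegenerate : (dotForm n).Nondegenerate :=
  Matrix.Nondegenerate.toBilin' (Matrix.nondegenerate_of_det_ne_zero (by simp))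

theorem chi_eq_one_of_mem_orthogonal {Λ : Submodule (ZMod 2) (Fin n → ZMod 2)}
    {S h : Fin n → ZMod 2} (hS : S ∈ Λ) (hh : h ∈ (dotForm n).orthogonal Λ) : chi S h = 1 := by
  have := hh S hS
  rw [dotForm_apply] at this
  simp [chi, this]

open Classical in
theorem sum_chi_orthogonal_eq_zero {Λ : Submodule (ZMod 2) (Fin n → ZMod 2)}
    {S : Fin n → ZMod 2} (hS : S ∉ Λ) :
    ∑ h with h ∈ (dotForm n).orthogonal Λ, chi S h = 0 := by
  obtain ⟨h₀, hh₀, hne⟩ : ∃ h₀ ∈ (dotForm n).orthogonal Λ, chi S h₀ = -1 := by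
    by_contra! hcon
    apply hS
    rw [← LinearMap.BilinForm.orthogonal_orthogonal dotForm_nondegenerate dotForm_isRefl Λ]
    intro h hh
    have := hcon h hh
    rw [dotForm_apply]
    unfold chi at this
    simp only [mul_comm (h _)]
    by_contra hne
    rw [if_neg hne] at this
    exact this rfl
  have h1 : ∑ h with h ∈ (dotForm n).orthogonal Λ, chi S h =
      ∑ h with h ∈ (dotForm n).orthogonal Λ, chi S (h + h₀) := by
    refine (sum_bij' (fun h _ => h + h₀) (fun h _ => h - h₀) ?_ ?_ ?_ ?_ ?_).symm
    · intro h hh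
      simp only [mem_filter, mem_univ, true_and] at hh ⊢
      exact add_mem hh hh₀
    · intro h hh
      simp only [mem_filter, mem_univ, true_and] at hh ⊢
      exact sub_mem hh hh₀
    · simp
    · simp
    · simp
  simp only [chi_add_right, hne, mul_neg, mul_one, sum_neg_distrib] at h1
  linarith

/-- If `c` has little mass on all cosets of `Λ` other than `Λ` itself, then on each coset of the
annihilator of `Λ` the function with Fourier coefficients `c` takes a value close to that of its
projection to the characters in `Λ`. -/
theorem exists_mem_orthogonal_sq_sub_le (c : (Fin n → ZMod 2) → ℝ)
    (Λ : Submodule (ZMod 2) (Fin n → ZMod 2)) (M η : ℝ) (hη : 0 ≤ η) (hc : ∑ S, |c S| ≤ M)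
    (hΛ : ∀ ξ ∉ Λ, ∑ S, Set.indicator {S | S + ξ ∈ Λ} (fun S => |c S|) S ≤ η)
    (x : Fin n → ZMod 2) :
    ∃ h ∈ (dotForm n).orthogonal Λ,
      (fourierSum c (x + h) - fourierSum (Set.indicator Λ c) x) ^ 2 ≤ M * η := by
  classical
  set d : (Fin n → ZMod 2) → ℝ := fun S => if S ∈ Λ then 0 else c S * chi S x with hd
  have hdc : ∀ S, |d S| ≤ |c S| := fun S => by
    simp only [hd]
    split_ifs
    · simp
    · rw [abs_mul, abs_chi, mul_one]
  set H := (dotForm n).orthogonal Λ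
  set HF : Finset (Fin n → ZMod 2) := univ.filter (· ∈ H) with hHF
  have hg : ∀ h ∈ H, fourierSum c (x + h) - fourierSum (Set.indicator Λ c) x =
      ∑ S, d S * chi S h := by
    intro h hh
    simp only [fourierSum, ← sum_sub_distrib]
    refine sum_congr rfl fun S _ => ?_
    by_cases hS : S ∈ Λ
    · simp [hd, hS, chi_add_right, chi_eq_one_of_mem_orthogonal hS hh]
    · simp [hd, hS, chi_add_right, mul_assoc]
  have hsum : ∑ h ∈ HF, (∑ S, d S * chi S h) ^ 2 ≤ ∑ h ∈ HF, M * η := by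
    have h1 : ∑ h ∈ HF, (∑ S, d S * chi S h) ^ 2 =
        ∑ S, ∑ S', d S * d S' * ∑ h ∈ HF, chi (S + S') h := by
      simp only [sq, sum_mul_sum]
      rw [sum_comm]
      refine sum_congr rfl fun S _ => ?_
      rw [sum_comm]
      refine sum_congr rfl fun S' _ => ?_
      rw [mul_sum]
      refine sum_congr rfl fun h _ => ?_
      rw [chi_add_left]; ring
    have h2 : ∀ S, ∑ S', d S * d S' * ∑ h ∈ HF, chi (S + S') h ≤ |c S| * (η * #HF) := by
      intro S
      by_cases hS : S ∈ Λ
      · simp only [hd, hS, if_true, zero_mul, sum_const_zero]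
        positivity
      · have h3 : ∀ S', d S * d S' * ∑ h ∈ HF, chi (S + S') h ≤
            |c S| * (Set.indicator {T | T + S ∈ Λ} (fun T => |c T|) S' * #HF) := by
          intro S'
          by_cases hSS : S' + S ∈ Λ
          · have h4 : |∑ h ∈ HF, chi (S + S') h| ≤ #HF := by
              refine (abs_sum_le_sum_abs _ _).trans ?_
              simp [abs_chi]
            rw [Set.indicator_of_mem (show S' ∈ {T | T + S ∈ Λ} from hSS)]
            refine (le_abs_self _).trans ?_
            rw [abs_mul, abs_mul, mul_assoc]
            exact mul_le_mul (hdc S) (mul_le_mul (hdc S') h4 (abs_nonneg _) (abs_nonneg _))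
              (by positivity) (abs_nonneg _)
          · rw [Set.indicator_of_notMem (show S' ∉ {T | T + S ∈ Λ} from hSS), hHF,
              sum_chi_orthogonal_eq_zero (by rwa [add_comm])]
            simp
        refine (sum_le_sum fun S' _ => h3 S').trans ?_
        rw [← mul_sum, ← sum_mul]
        gcongr
        exact hΛ S hS
    rw [h1]
    refine (sum_le_sum fun S _ => h2 S).trans ?_
    rw [← sum_mul, sum_const, nsmul_eq_mul]
    calc (∑ S, |c S|) * (η * #HF) ≤ M * (η * #HF) := by gcongr
      _ = #HF * (M * η) := by ring
  obtain ⟨h, hh, hle⟩ := exists_le_of_sum_le ⟨0, by simp [hHF]⟩ hsum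
  have hhH : h ∈ H := (mem_filter.1 hh).2
  exact ⟨h, hhH, by rw [hg h hhH]; exact hle⟩

/-- Every subspace extends, with control on the dimension, to one off which `c` is spread out. -/
theorem exists_subspace_sum_indicator_le (c : (Fin n → ZMod 2) → ℝ)
    (Λ₀ : Submodule (ZMod 2) (Fin n → ZMod 2)) (M η : ℝ) (hη : 0 < η) (hc : ∑ S, |c S| ≤ M) :
    ∃ Λ ≥ Λ₀, Module.finrank (ZMod 2) Λ * η ≤ Module.finrank (ZMod 2) Λ₀ * η + M ∧
      ∀ ξ ∉ Λ, ∑ S, Set.indicator {S | S + ξ ∈ Λ} (fun S => |c S|) S ≤ η := by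
  classical
  set mass : Submodule (ZMod 2) (Fin n → ZMod 2) → ℝ := fun Λ =>
    ∑ S, Set.indicator (Λ : Set (Fin n → ZMod 2)) (fun S => |c S|) S with hmass
  have hm0 : ∀ Λ, 0 ≤ mass Λ := fun Λ =>
    sum_nonneg fun S _ => Set.indicator_nonneg (fun _ _ => abs_nonneg _) _
  have hm1 : ∀ Λ, mass Λ ≤ M := fun Λ => le_trans
    (sum_le_sum fun S _ => Set.indicator_le_self' (fun _ _ => abs_nonneg _) _) hc
  have : Nonempty {Λ : Submodule (ZMod 2) (Fin n → ZMod 2) // Λ₀ ≤ Λ} := ⟨⟨Λ₀, le_rfl⟩⟩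
  obtain ⟨⟨Λ, hΛ⟩, hmax⟩ := Finite.exists_max
    (fun Λ : {Λ : Submodule (ZMod 2) (Fin n → ZMod 2) // Λ₀ ≤ Λ} =>
      mass Λ - Module.finrank (ZMod 2) Λ * η)
  refine ⟨Λ, hΛ, ?_, fun ξ hξ => ?_⟩
  · have := hmax ⟨Λ₀, le_rfl⟩
    simp only at this
    linarith [hm0 Λ₀, hm1 Λ]
  · have h1 := hmax ⟨Λ ⊔ Submodule.span (ZMod 2) {ξ}, hΛ.trans le_sup_left⟩
    simp only at h1
    have h2 : (Module.finrank (ZMod 2) ↥(Λ ⊔ Submodule.span (ZMod 2) {ξ}) : ℝ) ≤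
        Module.finrank (ZMod 2) Λ + 1 := by
      have h3 := Submodule.finrank_add_le_finrank_add_finrank Λ (Submodule.span (ZMod 2) {ξ})
      have h4 := finrank_span_le_card (R := ZMod 2) ({ξ} : Set (Fin n → ZMod 2))
      simp only [Set.toFinset_singleton, card_singleton] at h4
      exact_mod_cast h3.trans (by omega)
    have h5 : mass Λ + ∑ S, Set.indicator {S | S + ξ ∈ Λ} (fun S => |c S|) S ≤
        mass (Λ ⊔ Submodule.span (ZMod 2) {ξ}) := by
      simp only [hmass]
      rw [← sum_add_distrib]
      refine sum_le_sum fun S _ => ?_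
      have hξ' : ξ ∈ Λ ⊔ Submodule.span (ZMod 2) {ξ} :=
        Submodule.mem_sup_right (Submodule.mem_span_singleton_self ξ)
      by_cases hS : S ∈ Λ
      · have h6 : S + ξ ∉ Λ := fun h => hξ (by simpa using sub_mem h hS)
        have h7 : S ∈ Λ ⊔ Submodule.span (ZMod 2) {ξ} := Submodule.mem_sup_left hS
        simp [Set.indicator, hS, h6, h7]
      · by_cases h6 : S + ξ ∈ Λ
        · have h7 : S ∈ Λ ⊔ Submodule.span (ZMod 2) {ξ} := by
            simpa using sub_mem (Submodule.mem_sup_left h6 :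
              S + ξ ∈ Λ ⊔ Submodule.span (ZMod 2) {ξ}) hξ'
          simp [Set.indicator, hS, h6, h7]
        · simp only [Set.indicator, SetLike.mem_coe, hS, Set.mem_ofPred_eq, h6, if_false, add_zero]
          split_ifs <;> simp
    have h8 : (Module.finrank (ZMod 2) ↥(Λ ⊔ Submodule.span (ZMod 2) {ξ}) : ℝ) * η ≤
        (Module.finrank (ZMod 2) Λ + 1) * η := mul_le_mul_of_nonneg_right h2 hη.le
    linarith

/-- A set meeting more than `2 ^ m` cosets of `H` contains `m` points independent modulo `H`. -/
theorem exists_linearIndependent_mkQ (H : Submodule (ZMod 2) (Fin n → ZMod 2))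
    (A : Set (Fin n → ZMod 2)) (m : ℕ) (hA : 2 ^ m < (H.mkQ '' A).ncard) :
    ∃ x : ℕ → Fin n → ZMod 2, (∀ i < m, x i ∈ A) ∧
      LinearIndependent (ZMod 2) (fun i : Fin m => H.mkQ (x i)) := by
  classical
  obtain ⟨b, hbs, hspan, hlin⟩ := exists_linearIndependent (ZMod 2) (H.mkQ '' A)
  have : Fintype ((Fin n → ZMod 2) ⧸ H) := Fintype.ofFinite _
  have : Fintype b := Fintype.ofFinite _
  have h1 : (H.mkQ '' A).ncard ≤ 2 ^ Fintype.card b := by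
    have h2 : (H.mkQ '' A).ncard ≤ (Submodule.span (ZMod 2) b :
        Set ((Fin n → ZMod 2) ⧸ H)).ncard :=
      Set.ncard_le_ncard (by rw [hspan]; exact Submodule.subset_span) (Set.toFinite _)
    refine h2.trans (le_of_eq ?_)
    have h3 : Module.finrank (ZMod 2) (Submodule.span (ZMod 2) b) = Fintype.card b := by
      have := finrank_span_eq_card hlin
      rwa [Subtype.range_coe] at this
    rw [← h3]
    have h4 := Module.card_eq_pow_finrank (K := ZMod 2) (V := Submodule.span (ZMod 2) b)
    rw [ZMod.card, ← Nat.card_eq_fintype_card] at h4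
    exact h4
  have h2 : m ≤ Fintype.card b := by
    by_contra! hlt
    have := Nat.pow_le_pow_right (n := 2) (by norm_num) hlt.le
    omega
  obtain ⟨e⟩ : Nonempty (Fin m ↪ b) := by
    apply Function.Embedding.nonempty_of_card_le
    simpa using h2
  choose y hyA hy using fun q : b => hbs q.2
  refine ⟨fun i => if hi : i < m then y (e ⟨i, hi⟩) else 0, fun i hi => ?_, ?_⟩
  · simp only [hi, dif_pos]
    exact hyA _
  · have h3 := hlin.comp e e.injective
    have h4 : (fun i : Fin m => H.mkQ (if hi : (i : ℕ) < m then y (e ⟨i, hi⟩) else 0)) =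
        Subtype.val ∘ e := by
      funext i
      simp only [i.2, dif_pos, Function.comp]
      exact hy _
    rw [h4]
    exact h3

/-- If all odd sums of a family independent modulo `H` lie in an `H`-invariant set, then that set
contains a coset of a subspace of large dimension. -/
theorem exists_coset_subset_of_odd_sums (H : Submodule (ZMod 2) (Fin n → ZMod 2))
    (A : Set (Fin n → ZMod 2)) (hA : ∀ x ∈ A, ∀ h ∈ H, x + h ∈ A) (x : ℕ → Fin n → ZMod 2)
    (I : Finset ℕ) (d : ℕ) (hI : #I = d + 1)
    (hlin : LinearIndependent (ZMod 2) (fun i : I => H.mkQ (x i)))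
    (hodd : ∀ J ⊆ I, Odd #J → ∑ i ∈ J, x i ∈ A) :
    ∃ (a : Fin n → ZMod 2) (W : Submodule (ZMod 2) (Fin n → ZMod 2)),
      Module.finrank (ZMod 2) W = Module.finrank (ZMod 2) H + d ∧ ∀ w ∈ W, a + w ∈ A := by
  classical
  obtain ⟨i₀, hi₀⟩ : I.Nonempty := card_pos.1 (by omega)
  set v : {i : I // i ≠ ⟨i₀, hi₀⟩} → (Fin n → ZMod 2) ⧸ H := fun i => H.mkQ (x i - x i₀) with hv
  have hvlin : LinearIndependent (ZMod 2) v := by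
    have := (affineIndependent_iff_linearIndependent_vsub (ZMod 2) _ ⟨i₀, hi₀⟩).1
      hlin.affineIndependent
    simpa only [vsub_eq_sub, ← map_sub] using this
  set p := Submodule.span (ZMod 2) (Set.range v)
  have hp : Module.finrank (ZMod 2) p = d := by
    rw [finrank_span_eq_card hvlin]
    simp [hI]
  set W := p.comap H.mkQ with hW
  have hHW : H ≤ W := fun h hh => by
    rw [hW, Submodule.mem_comap, Submodule.mkQ_apply, (Submodule.Quotient.mk_eq_zero H).2 hh]
    exact zero_mem _
  refine ⟨x i₀, W, ?_, fun w hw => ?_⟩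
  · have h1 := LinearMap.finrank_range_add_finrank_ker (H.mkQ.domRestrict W)
    have h2 : (H.mkQ.domRestrict W).range = p := by
      rw [LinearMap.range_domRestrict, hW, Submodule.map_comap_eq, Submodule.range_mkQ, top_inf_eq]
    have h3 : (H.mkQ.domRestrict W).ker = H.comap W.subtype := by
      rw [LinearMap.ker_domRestrict, Submodule.ker_mkQ]
    rw [h2, h3, (Submodule.comapSubtypeEquivOfLe hHW).finrank_eq, hp] at h1
    omega
  · rw [hW, Submodule.mem_comap, Submodule.mem_span_range_iff_exists_fun] at hw
    obtain ⟨c, hc⟩ := hw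
    have h01 : ∀ a : ZMod 2, a = 0 ∨ a = 1 := by decide
    set J : Finset ℕ := ((univ.filter (fun i => c i = 1)).map
      (Function.Embedding.subtype _)).map (Function.Embedding.subtype _) with hJ
    have hJI : J ⊆ I := by
      intro j hj
      simp only [hJ, mem_map] at hj
      obtain ⟨k, -, rfl⟩ := hj
      exact k.2
    have hi₀J : i₀ ∉ J := by
      intro hj
      simp only [hJ, mem_map] at hj
      obtain ⟨k, ⟨l, -, rfl⟩, h⟩ := hj
      exact l.2 (Subtype.ext h)
    have hsum : H.mkQ (∑ i ∈ J, (x i - x i₀)) = H.mkQ w := by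
      rw [← hc, map_sum, hJ, sum_map, sum_map, sum_filter]
      refine sum_congr rfl fun i _ => ?_
      rcases h01 (c i) with h | h <;> simp [h, hv]
    have hdiff : w - ∑ i ∈ J, (x i - x i₀) ∈ H := by
      rw [← Submodule.ker_mkQ H, LinearMap.mem_ker, map_sub, hsum, sub_self]
    have hx2 : ∀ y : Fin n → ZMod 2, (2 : ℕ) • y = 0 := fun y => by
      ext i
      simp [CharTwo.two_eq_zero]
    have hmem : x i₀ + ∑ i ∈ J, (x i - x i₀) ∈ A := by
      rw [sum_sub_distrib, sum_const]
      rcases Nat.even_or_odd #J with he | ho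
      · obtain ⟨k, hk⟩ := he
        rw [hk, ← two_mul, mul_comm, mul_nsmul', hx2, smul_zero, sub_zero, ← sum_insert hi₀J]
        refine hodd _ (insert_subset hi₀ hJI) ?_
        rw [card_insert_of_notMem hi₀J, hk]
        exact ⟨k, by ring⟩
      · have h1 := hodd J hJI ho
        obtain ⟨k, hk⟩ := ho
        rw [hk, add_nsmul, mul_comm, mul_nsmul', hx2]
        simpa using h1
    have := hA _ hmem _ hdiff
    rwa [show x i₀ + ∑ i ∈ J, (x i - x i₀) + (w - ∑ i ∈ J, (x i - x i₀)) = x i₀ + w by abel] at this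

end Subspaces

section CosetCombinations

variable {n : ℕ}

open Classical in
/-- `g` is a `±1`-combination of at most `L` indicators of cosets of subgroups. -/
def IsCosetComb (L : ℕ) (g : (Fin n → ZMod 2) → ℤ) : Prop :=
  ∃ (ι : Type) (_ : Fintype ι) (ε : ι → ℤ) (H : ι → AddSubgroup (Fin n → ZMod 2))
    (a : ι → Fin n → ZMod 2), Fintype.card ι ≤ L ∧ (∀ i, ε i = 1 ∨ ε i = -1) ∧
      ∀ x, g x = ∑ i, ε i * if x - a i ∈ H i then 1 else 0

theorem IsCosetComb.mono {L L' : ℕ} {g : (Fin n → ZMod 2) → ℤ} (h : IsCosetComb L g)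
    (hL : L ≤ L') : IsCosetComb L' g := by
  obtain ⟨ι, _, ε, H, a, hc, hε, hg⟩ := h
  exact ⟨ι, _, ε, H, a, hc.trans hL, hε, hg⟩

theorem isCosetComb_zero (L : ℕ) : IsCosetComb L (0 : (Fin n → ZMod 2) → ℤ) :=
  ⟨Empty, inferInstance, fun _ => 1, fun _ => ⊥, fun _ => 0, by simp, by simp, by simp⟩

theorem IsCosetComb.add {L L' : ℕ} {g g' : (Fin n → ZMod 2) → ℤ} (h : IsCosetComb L g)
    (h' : IsCosetComb L' g') : IsCosetComb (L + L') (g + g') := by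
  obtain ⟨ι, _, ε, H, a, hc, hε, hg⟩ := h
  obtain ⟨ι', _, ε', H', a', hc', hε', hg'⟩ := h'
  refine ⟨ι ⊕ ι', inferInstance, Sum.elim ε ε', Sum.elim H H', Sum.elim a a', ?_, ?_, ?_⟩
  · rw [Fintype.card_sum]
    omega
  · rintro (i | i)
    exacts [hε i, hε' i]
  · intro x
    rw [Pi.add_apply, hg, hg', Fintype.sum_sum_type]
    rfl

theorem IsCosetComb.sum {κ : Type} {L : ℕ} (s : Finset κ) {g : κ → (Fin n → ZMod 2) → ℤ}
    (h : ∀ k ∈ s, IsCosetComb L (g k)) : IsCosetComb (#s * L) (∑ k ∈ s, g k) := by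
  classical
  induction s using Finset.induction_on with
  | empty => exact isCosetComb_zero _
  | insert k s hk ih =>
    rw [sum_insert hk, card_insert_of_notMem hk, add_mul, one_mul, add_comm (_ * L)]
    exact (h k (mem_insert_self _ _)).add (ih fun j hj => h j (mem_insert_of_mem hj))

open Classical in
theorem isCosetComb_const_mul (k : ℤ) (H : AddSubgroup (Fin n → ZMod 2))
    (a : Fin n → ZMod 2) :
    IsCosetComb k.natAbs (fun x => k * if x - a ∈ H then 1 else 0) := by
  rcases Int.natAbs_eq k with h | h
  · refine ⟨Fin k.natAbs, inferInstance, fun _ => 1, fun _ => H, fun _ => a, by simp, by simp, ?_⟩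
    intro x
    rw [sum_const, card_univ, Fintype.card_fin, nsmul_eq_mul, one_mul, ← h]
  · refine ⟨Fin k.natAbs, inferInstance, fun _ => -1, fun _ => H, fun _ => a, by simp, by simp, ?_⟩
    intro x
    rw [sum_const, card_univ, Fintype.card_fin, nsmul_eq_mul, ← mul_assoc, mul_neg_one, ← h]

/-- A bounded function invariant under `H` and supported on few cosets of `H` is a combination of
few indicators of cosets. -/
theorem isCosetComb_of_invariant (H : Submodule (ZMod 2) (Fin n → ZMod 2))
    (z : (Fin n → ZMod 2) → ℤ) (hz : ∀ x, ∀ h ∈ H, z (x + h) = z x) (B N : ℕ)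
    (hB : ∀ x, (z x).natAbs ≤ B) (hN : (H.mkQ '' {x | z x ≠ 0}).ncard ≤ N) :
    IsCosetComb (N * B) z := by
  classical
  have hfin : (H.mkQ '' {x | z x ≠ 0}).Finite := Set.toFinite _
  set Q := hfin.toFinset with hQ
  have hout : ∀ q : (Fin n → ZMod 2) ⧸ H, H.mkQ (Quotient.out q) = q := fun q =>
    Quotient.out_eq q
  have hmem : ∀ x (q : (Fin n → ZMod 2) ⧸ H), x - Quotient.out q ∈ H.toAddSubgroup ↔
      H.mkQ x = q := fun x q => by
    rw [Submodule.mem_toAddSubgroup, ← Submodule.Quotient.mk_eq_zero H, ← Submodule.mkQ_apply,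
      map_sub, hout, sub_eq_zero]
  have hsum : z = ∑ q ∈ Q, fun x => z (Quotient.out q) *
      if x - Quotient.out q ∈ H.toAddSubgroup then 1 else 0 := by
    funext x
    rw [Finset.sum_apply]
    simp only [hmem, mul_ite, mul_one, mul_zero, sum_ite_eq]
    have hx : z (Quotient.out (H.mkQ x)) = z x := by
      have h1 := (hmem x (H.mkQ x)).2 rfl
      rw [← hz _ _ h1, add_sub_cancel]
    rw [hx]
    split_ifs with h
    · rfl
    · by_contra hne
      exact h (hfin.mem_toFinset.2 ⟨x, hne, rfl⟩)
  rw [Set.ncard_eq_toFinset_card _ hfin] at hN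
  rw [hsum]
  exact (IsCosetComb.sum Q fun q _ => (isCosetComb_const_mul _ _ _).mono (hB _)).mono
    (Nat.mul_le_mul_right _ hN)

end CosetCombinations

section Structure

variable {n : ℕ}

theorem fourierSum_indicator_add_compl (c : (Fin n → ZMod 2) → ℝ) (Λ : Set (Fin n → ZMod 2))
    (x : Fin n → ZMod 2) :
    fourierSum (Set.indicator Λ c) x + fourierSum (Set.indicator Λᶜ c) x = fourierSum c x := by
  simp only [fourierSum, ← sum_add_distrib, ← add_mul]
  refine sum_congr rfl fun S _ => ?_
  rw [← Pi.add_apply, Set.indicator_self_add_compl]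

theorem sum_abs_indicator_add_compl (c : (Fin n → ZMod 2) → ℝ) (Λ : Set (Fin n → ZMod 2)) :
    ∑ S, |Set.indicator Λ c S| + ∑ S, |Set.indicator Λᶜ c S| = ∑ S, |c S| := by
  rw [← sum_add_distrib]
  refine sum_congr rfl fun S _ => ?_
  by_cases hS : S ∈ Λ <;> simp [hS]

theorem fourierSum_indicator_add_of_mem_orthogonal (c : (Fin n → ZMod 2) → ℝ)
    (Λ : Submodule (ZMod 2) (Fin n → ZMod 2)) (x : Fin n → ZMod 2) {h : Fin n → ZMod 2}
    (hh : h ∈ (dotForm n).orthogonal Λ) :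
    fourierSum (Set.indicator Λ c) (x + h) = fourierSum (Set.indicator Λ c) x := by
  refine sum_congr rfl fun S _ => ?_
  by_cases hS : S ∈ Λ
  · rw [chi_add_right, chi_eq_one_of_mem_orthogonal hS hh, mul_one]
  · simp [hS]

/-- A nonempty set contains a coset of a subspace of maximal dimension. -/
theorem exists_max_coset_subset {A : Set (Fin n → ZMod 2)} (hA : A.Nonempty) :
    ∃ (a : Fin n → ZMod 2) (V : Submodule (ZMod 2) (Fin n → ZMod 2)), (∀ v ∈ V, a + v ∈ A) ∧
      ∀ (b : Fin n → ZMod 2) (W : Submodule (ZMod 2) (Fin n → ZMod 2)), (∀ w ∈ W, b + w ∈ A) →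
        Module.finrank (ZMod 2) W ≤ Module.finrank (ZMod 2) V := by
  obtain ⟨a₀, ha₀⟩ := hA
  have : Nonempty {V : Submodule (ZMod 2) (Fin n → ZMod 2) // ∃ a, ∀ v ∈ V, a + v ∈ A} :=
    ⟨⟨⊥, a₀, fun v hv => by rwa [(Submodule.mem_bot _).1 hv, add_zero]⟩⟩
  obtain ⟨⟨V, a, hV⟩, hmax⟩ := Finite.exists_max
    (fun V : {V : Submodule (ZMod 2) (Fin n → ZMod 2) // ∃ a, ∀ v ∈ V, a + v ∈ A} =>
      Module.finrank (ZMod 2) V.1)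
  exact ⟨a, V, hV, fun b W hW => hmax ⟨W, b, hW⟩⟩

/-- Every subspace `V` contains, with control on its codimension in `V`, the annihilator of a
subspace off which `c` is spread out. -/
theorem exists_orthogonal_le (c : (Fin n → ZMod 2) → ℝ) (V : Submodule (ZMod 2) (Fin n → ZMod 2))
    (M η : ℝ) (d : ℕ) (hη : 0 < η) (hc : ∑ S, |c S| ≤ M) (hd : M < (d + 1) * η) :
    ∃ Λ : Submodule (ZMod 2) (Fin n → ZMod 2), (dotForm n).orthogonal Λ ≤ V ∧
      Module.finrank (ZMod 2) V ≤ Module.finrank (ZMod 2) ((dotForm n).orthogonal Λ) + d ∧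
      ∀ ξ ∉ Λ, ∑ S, Set.indicator {S | S + ξ ∈ Λ} (fun S => |c S|) S ≤ η := by
  obtain ⟨Λ, hΛ, hdim, hspread⟩ :=
    exists_subspace_sum_indicator_le c ((dotForm n).orthogonal V) M η hη hc
  refine ⟨Λ, ?_, ?_, hspread⟩
  · rw [← LinearMap.BilinForm.orthogonal_orthogonal dotForm_nondegenerate dotForm_isRefl V]
    exact LinearMap.BilinForm.orthogonal_le hΛ
  · have h1 := LinearMap.BilinForm.finrank_orthogonal dotForm_nondegenerate V
    have h2 := LinearMap.BilinForm.finrank_orthogonal dotForm_nondegenerate Λ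
    have h3 := Submodule.finrank_le V
    have h4 := Submodule.finrank_le Λ
    have h5 : (Module.finrank (ZMod 2) Λ : ℝ) <
        Module.finrank (ZMod 2) ((dotForm n).orthogonal V) + (d + 1) := by
      refine lt_of_mul_lt_mul_right ?_ hη.le
      linarith
    have h6 : Module.finrank (ZMod 2) Λ <
        Module.finrank (ZMod 2) ((dotForm n).orthogonal V) + (d + 1) := by
      exact_mod_cast h5
    omega

/-- An almost integer-valued function of spectral norm at most `k / 2` rounds to a combination of
boundedly many indicators of cosets. -/
theorem exists_isCosetComb_of_fourierSum (k : ℕ) : ∃ ε : ℝ, 0 < ε ∧ ∃ L : ℕ, ∀ (n : ℕ)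
    (c : (Fin n → ZMod 2) → ℝ) (z : (Fin n → ZMod 2) → ℤ), ∑ S, |c S| ≤ k / 2 →
      (∀ x, |fourierSum c x - z x| ≤ ε) → IsCosetComb L z := by
  induction k with
  | zero =>
    refine ⟨1 / 2, by norm_num, 0, fun n c z hc hz => ?_⟩
    have : z = 0 := by
      funext x
      have h1 := (abs_fourierSum_le c x).trans hc
      have h2 := hz x
      rw [abs_le] at h1 h2
      have h3 : (-1 : ℝ) < z x := by norm_num at h1; linarith
      have h4 : (z x : ℝ) < 1 := by norm_num at h1; linarith
      have h5 : -1 < z x := by exact_mod_cast h3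
      have h6 : z x < 1 := by exact_mod_cast h4
      rw [Pi.zero_apply]
      omega
    exact this ▸ isCosetComb_zero 0
  | succ k ih =>
    obtain ⟨ε', hε', L, hL⟩ := ih
    set M : ℝ := ((k + 1 : ℕ) : ℝ) / 2 with hM
    have hM0 : 0 < M := by positivity
    obtain ⟨ε₂, hε₂, -, hkey⟩ := exists_forall_odd_sum_ne_zero M hM0.le
    set ε₁ : ℝ := min (min ε' ε₂) (1 / 8) with hε₁
    have hε₁0 : 0 < ε₁ := by positivity
    have hle' : ε₁ ≤ ε' := (min_le_left _ _).trans (min_le_left _ _)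
    have hle₂ : ε₁ ≤ ε₂ := (min_le_left _ _).trans (min_le_right _ _)
    have hle8 : ε₁ ≤ 1 / 8 := min_le_right _ _
    set η : ℝ := (ε₁ / 4) ^ 2 / M with hη
    have hη0 : 0 < η := by positivity
    have hMη : M * η = (ε₁ / 4) ^ 2 := by rw [hη]; field_simp
    obtain ⟨d, hd⟩ := exists_nat_ge (M / η)
    have hd' : M < (d + 1) * η := by
      rw [div_le_iff₀ hη0] at hd
      linarith
    obtain ⟨m, hm⟩ := hkey (d + 2)
    obtain ⟨B, hB⟩ := exists_nat_ge (M + 1)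
    refine ⟨ε₁ / 4, by positivity, 2 * L + 2 ^ m * B, fun n c z hc hz => ?_⟩
    by_cases hz0 : z = 0
    · exact hz0 ▸ isCosetComb_zero _
    set A : Set (Fin n → ZMod 2) := {x | z x ≠ 0} with hA
    have hAne : A.Nonempty := Function.ne_iff.1 hz0
    obtain ⟨a, V, hV, hmax⟩ := exists_max_coset_subset hAne
    obtain ⟨Λ, hΛV, hdim, hspread⟩ := exists_orthogonal_le c V M η d hη0 hc hd'
    choose h hhΛ hh using fun x => exists_mem_orthogonal_sq_sub_le c Λ M η hη0.le hc hspread x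
    set H := (dotForm n).orthogonal Λ with hH
    set z₁ : (Fin n → ZMod 2) → ℤ := fun x => z (x + h x) with hz₁
    have hf₁ : ∀ x, |fourierSum (Set.indicator Λ c) x - z₁ x| ≤ ε₁ / 2 := fun x => by
      have h1 := hh x
      rw [hMη] at h1
      have h2 := abs_le_of_sq_le_sq' h1 (by positivity)
      have h3 := abs_le.1 (hz (x + h x))
      rw [abs_le]
      constructor <;> linarith
    have hf₂ : ∀ x, |fourierSum (Set.indicator (Λ : Set (Fin n → ZMod 2))ᶜ c) x -
        ((z - z₁) x : ℤ)| ≤ 3 / 4 * ε₁ := fun x => by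
      have h1 := abs_le.1 (hf₁ x)
      have h2 := abs_le.1 (hz x)
      have h3 := fourierSum_indicator_add_compl c Λ x
      rw [Pi.sub_apply, Int.cast_sub, abs_le]
      constructor <;> linarith
    have h_mass := sum_abs_indicator_add_compl c (Λ : Set (Fin n → ZMod 2))
    have h_massΛ : 1 / 2 ≤ ∑ S, |Set.indicator (Λ : Set (Fin n → ZMod 2)) c S| := by
      have h1 : (1 : ℝ) ≤ |(z₁ a : ℝ)| := by
        have h2 : z₁ a ≠ 0 := hV _ (hΛV (hhΛ a))
        exact_mod_cast Int.one_le_abs h2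
      have h2 := abs_fourierSum_le (Set.indicator (Λ : Set (Fin n → ZMod 2)) c) a
      have h3 := hf₁ a
      rw [abs_sub_comm] at h3
      have h4 := abs_sub_abs_le_abs_sub (z₁ a : ℝ) (fourierSum (Set.indicator Λ c) a)
      linarith
    by_cases hsplit : ∑ S, |Set.indicator (Λ : Set (Fin n → ZMod 2)) c S| ≤ k / 2
    · have h1 := hL n _ z₁ hsplit fun x => (hf₁ x).trans (by linarith)
      have h2 := hL n (Set.indicator (Λ : Set (Fin n → ZMod 2))ᶜ c) (z - z₁)
        (by rw [hM] at hc; push_cast at hc; linarith) fun x => (hf₂ x).trans (by linarith)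
      have h3 := h1.add h2
      rw [add_sub_cancel] at h3
      exact h3.mono (by omega)
    · push Not at hsplit
      have h_massc : ∑ S, |Set.indicator (Λ : Set (Fin n → ZMod 2))ᶜ c S| < 1 / 2 := by
        rw [hM] at hc; push_cast at hc; linarith
      have hzz : ∀ x, z₁ x = z x := fun x => by
        have h1 := abs_le.1 (abs_fourierSum_le (Set.indicator (Λ : Set (Fin n → ZMod 2))ᶜ c) x)
        have h2 := abs_le.1 (hf₂ x)
        have h3 : (-1 : ℝ) < ((z - z₁) x : ℤ) := by linarith
        have h4 : (((z - z₁) x : ℤ) : ℝ) < 1 := by linarith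
        have h5 : -1 < (z - z₁) x := by exact_mod_cast h3
        have h6 : (z - z₁) x < 1 := by exact_mod_cast h4
        rw [Pi.sub_apply] at h5 h6
        omega
      have hinv : ∀ x, ∀ y ∈ H, z (x + y) = z x := fun x y hy => by
        have h1 := abs_le.1 (hf₁ x)
        have h2 := abs_le.1 (hf₁ (x + y))
        rw [hzz] at h1 h2
        rw [fourierSum_indicator_add_of_mem_orthogonal c Λ x hy] at h2
        have h3 : (z (x + y) : ℝ) < z x + 1 := by linarith
        have h4 : (z x : ℝ) < z (x + y) + 1 := by linarith
        have h5 : z (x + y) < z x + 1 := by exact_mod_cast h3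
        have h6 : z x < z (x + y) + 1 := by exact_mod_cast h4
        omega
      refine (isCosetComb_of_invariant H z hinv B (2 ^ m) (fun x => ?_) ?_).mono (by omega)
      · have h1 := (abs_fourierSum_le c x).trans hc
        have h2 := hz x
        rw [abs_sub_comm] at h2
        have h3 := abs_sub_abs_le_abs_sub (z x : ℝ) (fourierSum c x)
        have h4 : |(z x : ℝ)| ≤ B := by linarith
        have h5 : |z x| ≤ B := by exact_mod_cast h4
        rw [Int.abs_eq_natAbs] at h5
        exact_mod_cast h5
      · by_contra! hlt
        obtain ⟨x, hxA, hlin⟩ := exists_linearIndependent_mkQ H A m hlt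
        obtain ⟨I, hIm, hI, hodd⟩ := hm n c z hc (fun x => (hz x).trans (by linarith)) x hxA
        obtain ⟨b, W, hW, hWA⟩ := exists_coset_subset_of_odd_sums H A
          (fun x hx y hy => by rw [hA, Set.mem_ofPred_eq, hinv x y hy]; exact hx) x I (d + 1) hI
          (hlin.comp (fun i : I => ⟨i, mem_range.1 (hIm i.2)⟩) fun i j hij =>
            Subtype.ext (Fin.mk.inj hij)) hodd
        have := hmax b W hWA
        omega

/-- Fourier inversion. -/
theorem fourierSum_fCoeff (f : (Fin n → ZMod 2) → ℝ) (x : Fin n → ZMod 2) :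
    fourierSum (fCoeff f) x = f x := by
  classical
  have horth : ∀ w : Fin n → ZMod 2, ∑ S, chi S w = if w = 0 then 2 ^ n else 0 := fun w => by
    split_ifs with hw
    · simp [hw, chi_zero_right]
    · have h1 := sum_chi_orthogonal_eq_zero (Λ := ⊥) (S := w) (by simpa using hw)
      rw [LinearMap.BilinForm.orthogonal_bot] at h1
      simpa [chi_comm w] using h1
  have h2 : ∀ S, fCoeff f S * chi S x = (2 ^ n : ℝ)⁻¹ * ∑ y, f y * chi S (y + x) := fun S => by
    rw [fCoeff, mul_assoc, sum_mul]
    simp only [chi_add_right, mul_assoc]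
  simp only [fourierSum, h2]
  rw [← mul_sum, sum_comm]
  simp only [← mul_sum, horth, mul_ite, mul_zero]
  have h3 : ∀ y : Fin n → ZMod 2, y + x = 0 ↔ y = x := fun y => by
    rw [← ZModModule.sub_eq_add, sub_eq_zero]
  simp only [h3, sum_ite_eq', mem_univ, if_true]
  field_simp

end Structure

end Rounding

open Classical in
/-- Quantitative Cohen's theorem for `𝔽₂ⁿ` (Green–Sanders): if `‖1_S‖_A ≤ c`, then `1_S`
is a `±1`-combination of at most `ℓ(c)` indicators of cosets of subgroups of `𝔽₂ⁿ`. -/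
theorem green_sanders (c : ℝ) (hc : 0 < c) :
    ∃ L : ℕ, 0 < L ∧ ∀ (n : ℕ), 1 ≤ n → ∀ S : Set (Fin n → ZMod 2),
      algebraNorm (Set.indicator S fun _ => (1 : ℝ)) ≤ c →
      ∃ (L' : ℕ) (_ : L' ≤ L) (ε : Fin L' → ℝ)
        (H : Fin L' → AddSubgroup (Fin n → ZMod 2)) (a : Fin L' → (Fin n → ZMod 2)),
        (∀ i, ε i = 1 ∨ ε i = -1) ∧
        ∀ x, Set.indicator S (fun _ => (1 : ℝ)) x =
          ∑ i, ε i * (if x - a i ∈ H i then (1 : ℝ) else 0) := by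
  obtain ⟨k, hk⟩ := exists_nat_ge (2 * c)
  obtain ⟨η, hη, L, hL⟩ := exists_isCosetComb_of_fourierSum k
  refine ⟨L + 1, L.succ_pos, fun n _ S hS => ?_⟩
  obtain ⟨ι, _, ε, H, a, hcard, hε, hx⟩ := hL n
    (fCoeff (Set.indicator S fun _ => (1 : ℝ))) (Set.indicator S fun _ => 1)
    (hS.trans (by linarith)) (fun x => by
      rw [fourierSum_fCoeff]
      by_cases hxS : x ∈ S <;> simp [hxS, hη.le])
  let e := (Fintype.equivFin ι).symm
  refine ⟨Fintype.card ι, by omega, fun i => ε (e i), fun i => H (e i), fun i => a (e i),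
    fun i => ?_, fun x => ?_⟩
  · rcases hε (e i) with h | h <;> simp [h]
  · rw [e.sum_comp fun i => (ε i : ℝ) * (if x - a i ∈ H i then (1 : ℝ) else 0)]
    have h1 : Set.indicator S (fun _ => (1 : ℝ)) x =
        ((Set.indicator S (fun _ => (1 : ℤ)) x : ℤ) : ℝ) := by
      by_cases hxS : x ∈ S <;> simp [hxS]
    rw [h1, hx]
    push_cast
    rfl
end

section
/- Every sign matrix F ∈ {−1,1}^{X×Y} on finite sets X, Y with sign-rank d contains a monochromatic rectangle of dimensions at least |X|/2^{d+1} by |Y|/2^{d+1}; that is, there exist S ⊆ X and T ⊆ Y with |S| ≥ |X|/2^{d+1}, |T| ≥ |Y|/2^{d+1}, and F constant on S×T. -/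
open scoped BigOperators

/-- `OrthantSystem W L`: the sets in the list `L` are the cells of a generalized orthant
decomposition (a binary tree of sign conditions) adapted to the family of functions `W`. -/
inductive OrthantSystem {X : Type*} : Set (X → ℝ) → List (Finset X) → Prop
  | leaf (W : Set (X → ℝ)) (P : Finset X) (h : ∀ w ∈ W, ∀ x ∈ P, w x = 0) : OrthantSystem W [P]
  | node (W W₁ W₂ : Set (X → ℝ)) (L₁ L₂ : List (Finset X)) (b : X → ℝ)
      (hpos : ∀ P ∈ L₁, ∀ x ∈ P, 0 < b x) (hneg : ∀ P ∈ L₂, ∀ x ∈ P, b x < 0)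
      (h₁ : OrthantSystem W₁ L₁) (h₂ : OrthantSystem W₂ L₂)
      (hW : ∀ w ∈ W, ∃ β : ℝ, (∃ w₁ ∈ W₁, ∀ P ∈ L₁, ∀ x ∈ P, w x = β * b x + w₁ x) ∧
        ∃ w₂ ∈ W₂, ∀ P ∈ L₂, ∀ x ∈ P, w x = β * b x + w₂ x) :
      OrthantSystem W (L₁ ++ L₂)

namespace OrthantSystem

variable {X : Type*}

theorem mono {W W' : Set (X → ℝ)} {L : List (Finset X)} (h : OrthantSystem W L)
    (hW : W' ⊆ W) : OrthantSystem W' L := by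
  cases h with
  | leaf _ P h => exact leaf _ _ fun w hw => h w (hW hw)
  | node _ W₁ W₂ L₁ L₂ b hpos hneg h₁ h₂ h =>
    exact node _ W₁ W₂ L₁ L₂ b hpos hneg h₁ h₂ fun w hw => h w (hW hw)

/-- Every function of the family is nonnegative on some cell. -/
theorem exists_nonneg {W : Set (X → ℝ)} {L : List (Finset X)} (h : OrthantSystem W L) :
    ∀ w ∈ W, ∃ P ∈ L, ∀ x ∈ P, 0 ≤ w x := by
  induction h with
  | leaf W P h => exact fun w hw => ⟨P, by simp, fun x hx => (h w hw x hx).ge⟩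
  | node W W₁ W₂ L₁ L₂ b hpos hneg _ _ hW ih₁ ih₂ =>
    intro w hw
    obtain ⟨β, ⟨w₁, hw₁, e₁⟩, w₂, hw₂, e₂⟩ := hW w hw
    rcases le_total 0 β with hβ | hβ
    · obtain ⟨P, hP, h⟩ := ih₁ w₁ hw₁
      refine ⟨P, by simp [hP], fun x hx => ?_⟩
      rw [e₁ P hP x hx]
      exact add_nonneg (mul_nonneg hβ (hpos P hP x hx).le) (h x hx)
    · obtain ⟨P, hP, h⟩ := ih₂ w₂ hw₂
      refine ⟨P, by simp [hP], fun x hx => ?_⟩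
      rw [e₂ P hP x hx]
      exact add_nonneg (mul_nonneg_of_nonpos_of_nonpos hβ (hneg P hP x hx).le) (h x hx)

end OrthantSystem

theorem exists_pos_forall_le_of_finite {ι : Type*} [Finite ι] (f : ι → ℝ) (hf : ∀ i, 0 < f i) :
    ∃ δ > 0, ∀ i, δ ≤ f i := by
  cases isEmpty_or_nonempty ι
  · exact ⟨1, one_pos, fun i => isEmptyElim i⟩
  · obtain ⟨i, hi⟩ := Finite.exists_min f
    exact ⟨f i, hf i, hi⟩

/-- The `m`-th largest value of `a` on `P`. -/
theorem exists_order_statistic {X : Type*} (P : Finset X) (m : ℕ) (hm : 0 < m) (hP : m ≤ P.card)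
    (a : X → ℝ) : ∃ c : ℝ, m ≤ {x ∈ P | c ≤ a x}.card ∧ {x ∈ P | c < a x}.card < m := by
  classical
  have hne : P.Nonempty := Finset.card_pos.mp (hm.trans_le hP)
  obtain ⟨z, hz, hmin⟩ := P.exists_min_image a hne
  have hne' : {y ∈ P | m ≤ {x ∈ P | a y ≤ a x}.card}.Nonempty := by
    refine ⟨z, Finset.mem_filter.mpr ⟨hz, ?_⟩⟩
    rwa [Finset.filter_true_of_mem hmin]
  obtain ⟨y, hy, hmax⟩ := Finset.exists_max_image _ a hne'
  rw [Finset.mem_filter] at hy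
  refine ⟨a y, hy.2, ?_⟩
  by_contra! hlt
  obtain ⟨u, hu, humin⟩ := Finset.exists_min_image _ a (Finset.card_pos.mp (hm.trans_le hlt))
  rw [Finset.mem_filter] at hu
  refine absurd (hmax u (Finset.mem_filter.mpr ⟨hu.1, hlt.trans (Finset.card_le_card ?_)⟩))
    (not_le.mpr hu.2)
  intro x hx
  exact Finset.mem_filter.mpr ⟨(Finset.mem_filter.mp hx).1, humin x hx⟩

theorem order_statistic_add_le {X : Type*} (P : Finset X) (m : ℕ) (a a' : X → ℝ) (c c' k : ℝ)
    (hc : m ≤ {x ∈ P | c ≤ a x}.card) (hc' : {x ∈ P | c' < a' x}.card < m)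
    (h : ∀ x ∈ P, a x + k ≤ a' x) : c + k ≤ c' := by
  by_contra! hlt
  refine absurd (hc.trans (Finset.card_le_card ?_)) (not_le.mpr hc')
  intro x hx
  rw [Finset.mem_filter] at hx ⊢
  exact ⟨hx.1, by linarith [h x hx.1]⟩

/-- Two translation-equivariant monotone functionals can be equalized along a direction `b`
which is positive where the first one lives and negative where the second one lives. -/
theorem exists_balancing_shift {X : Type*} [Finite X] (A B : Set X) (M₁ M₂ : (X → ℝ) → ℝ)
    (mono₁ : ∀ a a' k, (∀ x ∈ A, a x + k ≤ a' x) → M₁ a + k ≤ M₁ a')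
    (mono₂ : ∀ a a' k, (∀ x ∈ B, a x + k ≤ a' x) → M₂ a + k ≤ M₂ a')
    (b : X → ℝ) (hA : ∀ x ∈ A, 0 < b x) (hB : ∀ x ∈ B, b x < 0) (a : X → ℝ) :
    ∃ τ : ℝ, M₁ (fun x => a x + τ * b x) = M₂ (fun x => a x + τ * b x) := by
  obtain ⟨δ, hδ, hδA⟩ := exists_pos_forall_le_of_finite (fun x : A => b x) fun x => hA x x.2
  obtain ⟨K, hK⟩ : ∃ K : NNReal, ∀ x, |b x| ≤ K := by
    obtain ⟨K, hK⟩ := (Set.finite_range fun x => |b x|).bddAbove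
    exact ⟨K.toNNReal, fun x => (hK ⟨x, rfl⟩).trans (Real.le_coe_toNNReal K)⟩
  have key : ∀ (s t : ℝ) x, a x + s * b x + -(K * dist s t) ≤ a x + t * b x := by
    intro s t x
    have h := le_abs_self ((s - t) * b x)
    rw [abs_mul] at h
    rw [Real.dist_eq]
    nlinarith [mul_le_mul_of_nonneg_left (hK x) (abs_nonneg (s - t))]
  have cont₁ : Continuous fun τ : ℝ => M₁ fun x => a x + τ * b x :=
    (LipschitzWith.of_le_add_mul K fun s t => by
      linarith [mono₁ _ _ _ fun x (_ : x ∈ A) => key s t x]).continuous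
  have cont₂ : Continuous fun τ : ℝ => M₂ fun x => a x + τ * b x :=
    (LipschitzWith.of_le_add_mul K fun s t => by
      linarith [mono₂ _ _ _ fun x (_ : x ∈ B) => key s t x]).continuous
  set C := |M₁ a - M₂ a| / δ with hC
  have hC0 : 0 ≤ C := by positivity
  have hCδ : C * δ = |M₁ a - M₂ a| := by rw [hC]; field_simp
  have hAδ : ∀ x ∈ A, C * δ ≤ C * b x := fun x hx =>
    mul_le_mul_of_nonneg_left (hδA ⟨x, hx⟩) hC0
  have hBC : ∀ x ∈ B, C * b x ≤ 0 := fun x hx =>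
    mul_nonpos_of_nonneg_of_nonpos hC0 (hB x hx).le
  have up₁ := mono₁ a (fun x => a x + C * b x) (C * δ) fun x hx => by linarith [hAδ x hx]
  have up₂ := mono₂ (fun x => a x + C * b x) a 0 fun x hx => by linarith [hBC x hx]
  have dn₁ := mono₁ (fun x => a x + -C * b x) a (C * δ) fun x hx => by linarith [hAδ x hx]
  have dn₂ := mono₂ a (fun x => a x + -C * b x) 0 fun x hx => by linarith [hBC x hx]
  obtain ⟨τ, hτ⟩ := mem_range_of_exists_le_of_exists_ge (c := (0 : ℝ)) (cont₁.sub cont₂)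
    ⟨-C, sub_nonpos.mpr (by linarith [le_abs_self (M₁ a - M₂ a)])⟩
    ⟨C, sub_nonneg.mpr (by linarith [neg_abs_le (M₁ a - M₂ a)])⟩
  exact ⟨τ, sub_eq_zero.mp hτ⟩

namespace OrthantSystem

variable {X : Type*}

/-- A generalized median of functions with respect to an orthant system; splitting every cell at
this value adds one more function (up to a small perturbation) to the family. -/
theorem exists_median [Finite X] {W : Set (X → ℝ)} {L : List (Finset X)}
    (h : OrthantSystem W L) (m : ℕ) (hm : 0 < m) (hL : ∀ P ∈ L, 2 * m ≤ P.card)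
    (ε : ℝ) (hε : 0 < ε) :
    ∃ M : (X → ℝ) → ℝ,
      (∀ a a' k, (∀ x ∈ {x | ∃ P ∈ L, x ∈ P}, a x + k ≤ a' x) → M a + k ≤ M a') ∧
      ∀ a, ∃ (a' : X → ℝ) (L' : List (Finset X)), (∀ x, |a' x - a x| ≤ ε) ∧
        OrthantSystem {f | ∃ w ∈ W, ∃ γ : ℝ, ∀ x, f x = w x + γ * (a' x - M a)} L' ∧
        L'.length = 2 * L.length ∧ ∀ P' ∈ L', m ≤ P'.card ∧ ∃ P ∈ L, P' ⊆ P := by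
  classical
  induction h with
  | leaf W P h =>
    have hP : 2 * m ≤ P.card := hL P (by simp)
    choose M hM hM' using exists_order_statistic P m hm (by omega)
    refine ⟨M, fun a a' k hk => order_statistic_add_le P m a a' _ _ k (hM a) (hM' a')
      fun x hx => hk x ⟨P, by simp, hx⟩, fun a => ?_⟩
    obtain ⟨Q, hQ₁, hQ₂, hQ⟩ := Finset.exists_subsuperset_card_eq
      (Finset.monotone_filter_right P fun x (_ : x ∈ P) (hx : M a < a x) => hx.le) (hM' a).le (hM a)
    have hQP : Q ⊆ P := hQ₂.trans (Finset.filter_subset _ _)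
    have hge : ∀ x ∈ Q, M a ≤ a x := fun x hx => (Finset.mem_filter.mp (hQ₂ hx)).2
    have hle : ∀ x ∈ P \ Q, a x ≤ M a := by
      intro x hx
      rw [Finset.mem_sdiff] at hx
      by_contra! hlt
      exact hx.2 (hQ₁ (Finset.mem_filter.mpr ⟨hx.1, hlt⟩))
    refine ⟨fun x => if x ∈ Q then a x + ε else a x - ε, [Q] ++ [P \ Q], fun x => ?_, ?_, rfl, ?_⟩
    · beta_reduce
      split_ifs <;> simp [abs_of_pos hε]
    · refine node _ {0} {0} [Q] [P \ Q]
        (fun x => (if x ∈ Q then a x + ε else a x - ε) - M a) ?_ ?_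
        (leaf _ _ (by simp)) (leaf _ _ (by simp)) ?_
      · simp only [List.mem_singleton, forall_eq]
        intro x hx
        rw [if_pos hx]
        linarith [hge x hx]
      · simp only [List.mem_singleton, forall_eq]
        intro x hx
        rw [if_neg (Finset.mem_sdiff.mp hx).2]
        linarith [hle x hx]
      · rintro f ⟨w, hw, γ, hf⟩
        refine ⟨γ, ⟨0, rfl, ?_⟩, 0, rfl, ?_⟩
        · simp only [List.mem_singleton, forall_eq]
          intro x hx
          rw [hf, h w hw x (hQP hx)]
          simp
        · simp only [List.mem_singleton, forall_eq]
          intro x hx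
          rw [hf, h w hw x (Finset.mem_sdiff.mp hx).1]
          simp
    · have hcard : (P \ Q).card = P.card - m := by rw [Finset.card_sdiff_of_subset hQP, hQ]
      intro P' hP'
      simp only [List.cons_append, List.nil_append, List.mem_cons, List.not_mem_nil,
        or_false] at hP'
      rcases hP' with rfl | rfl
      · exact ⟨hQ.ge, P, by simp, hQP⟩
      · exact ⟨by omega, P, by simp, Finset.sdiff_subset⟩
  | node W W₁ W₂ L₁ L₂ b hpos hneg _ _ hW ih₁ ih₂ =>
    obtain ⟨M₁, mono₁, ext₁⟩ := ih₁ fun P hP => hL P (by simp [hP])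
    obtain ⟨M₂, mono₂, ext₂⟩ := ih₂ fun P hP => hL P (by simp [hP])
    have hpos' : ∀ x ∈ {x | ∃ P ∈ L₁, x ∈ P}, 0 < b x := fun x ⟨P, hP, hx⟩ => hpos P hP x hx
    have hneg' : ∀ x ∈ {x | ∃ P ∈ L₂, x ∈ P}, b x < 0 := fun x ⟨P, hP, hx⟩ => hneg P hP x hx
    choose τ hτ using exists_balancing_shift _ _ M₁ M₂ mono₁ mono₂ b hpos' hneg'
    refine ⟨fun a => M₁ fun x => a x + τ a * b x, fun a a' k hk => ?_, fun a => ?_⟩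
    · rcases le_total (τ a) (τ a') with hle | hle
      · refine mono₁ _ _ _ fun x hx => ?_
        have hx' := hpos' x hx
        obtain ⟨P, hP, hx⟩ := hx
        have := hk x ⟨P, by simp [hP], hx⟩
        nlinarith
      · simp only [hτ]
        refine mono₂ _ _ _ fun x hx => ?_
        have hx' := hneg' x hx
        obtain ⟨P, hP, hx⟩ := hx
        have := hk x ⟨P, by simp [hP], hx⟩
        nlinarith
    · obtain ⟨a₁, L₁', close₁, sys₁, len₁, card₁⟩ := ext₁ fun x => a x + τ a * b x
      obtain ⟨a₂, L₂', close₂, sys₂, len₂, card₂⟩ := ext₂ fun x => a x + τ a * b x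
      rw [← hτ a] at sys₂
      set c := M₁ fun x => a x + τ a * b x with hc
      have pos₁ : ∀ P' ∈ L₁', ∀ x ∈ P', 0 < b x := fun P' hP' x hx => by
        obtain ⟨P, hP, hsub⟩ := (card₁ P' hP').2
        exact hpos P hP x (hsub hx)
      have neg₂ : ∀ P' ∈ L₂', ∀ x ∈ P', b x < 0 := fun P' hP' x hx => by
        obtain ⟨P, hP, hsub⟩ := (card₂ P' hP').2
        exact hneg P hP x (hsub hx)
      refine ⟨fun x => (if 0 < b x then a₁ x else a₂ x) - τ a * b x, L₁' ++ L₂', fun x => ?_,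
        node _ _ _ L₁' L₂' b pos₁ neg₂ sys₁ sys₂ ?_, ?_, ?_⟩
      · have e₁ := close₁ x
        have e₂ := close₂ x
        beta_reduce
        split_ifs
        · rwa [sub_sub, add_comm (τ a * b x)]
        · rwa [sub_sub, add_comm (τ a * b x)]
      · rintro f ⟨w, hw, γ, hf⟩
        obtain ⟨β, ⟨w₁, hw₁, e₁⟩, w₂, hw₂, e₂⟩ := hW w hw
        refine ⟨β - γ * τ a, ⟨fun x => w₁ x + γ * (a₁ x - c), ⟨w₁, hw₁, γ, fun x => rfl⟩, ?_⟩,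
          fun x => w₂ x + γ * (a₂ x - c), ⟨w₂, hw₂, γ, fun x => rfl⟩, ?_⟩
        · intro P' hP' x hx
          obtain ⟨P, hP, hsub⟩ := (card₁ P' hP').2
          rw [hf]
          beta_reduce
          rw [if_pos (pos₁ P' hP' x hx), e₁ P hP x (hsub hx)]
          ring
        · intro P' hP' x hx
          obtain ⟨P, hP, hsub⟩ := (card₂ P' hP').2
          rw [hf]
          beta_reduce
          rw [if_neg (neg₂ P' hP' x hx).not_gt, e₂ P hP x (hsub hx)]
          ring
      · simp only [List.length_append, len₁, len₂]
        ring
      · intro P' hP'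
        rcases List.mem_append.mp hP' with hP' | hP'
        · obtain ⟨hcard, P, hP, hsub⟩ := card₁ P' hP'
          exact ⟨hcard, P, by simp [hP], hsub⟩
        · obtain ⟨hcard, P, hP, hsub⟩ := card₂ P' hP'
          exact ⟨hcard, P, by simp [hP], hsub⟩

end OrthantSystem

/-- A discrete Yao–Yao partition theorem: up to an arbitrarily small perturbation, a finite set of
points in `ℝⁿ` has a center `c` and a system of `2 ^ n` cells of nearly equal size such that every
closed half-space bounded by a hyperplane through `c` contains one of the cells. -/
theorem exists_orthantSystem {X : Type*} [Fintype X] (m : ℕ) (hm : 0 < m) (ε : ℝ) (hε : 0 < ε)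
    (n : ℕ) (g : Fin n → X → ℝ) (hX : m * 2 ^ n ≤ Fintype.card X) :
    ∃ (g' : Fin n → X → ℝ) (c : Fin n → ℝ) (L : List (Finset X)),
      (∀ i x, |g' i x - g i x| ≤ ε) ∧
      OrthantSystem {f | ∃ v : Fin n → ℝ, ∀ x, f x = ∑ i, v i * (g' i x - c i)} L ∧
      L.length = 2 ^ n ∧ ∀ P ∈ L, m ≤ P.card := by
  induction n generalizing m with
  | zero =>
    refine ⟨g, 0, [Finset.univ], fun i => i.elim0, OrthantSystem.leaf _ _ ?_, rfl, ?_⟩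
    · rintro f ⟨v, hf⟩ x -
      simp [hf]
    · simpa using hX
  | succ n ih =>
    obtain ⟨g', c, L, close, sys, len, card⟩ :=
      ih (2 * m) (by omega) (fun i => g i.castSucc) (by rw [pow_succ] at hX; linarith)
    obtain ⟨M, -, ext⟩ := sys.exists_median m hm card ε hε
    obtain ⟨a', L', close', sys', len', card'⟩ := ext (g (Fin.last n))
    refine ⟨Fin.snoc (α := fun _ => X → ℝ) g' a',
      Fin.snoc (α := fun _ => ℝ) c (M (g (Fin.last n))), L', fun i => ?_,
      sys'.mono ?_, by rw [len', len, pow_succ]; ring, fun P hP => (card' P hP).1⟩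
    · refine Fin.lastCases ?_ (fun j => ?_) i
      · simpa using close'
      · simpa using close j
    · rintro f ⟨v, hf⟩
      refine ⟨fun x => ∑ i, v i.castSucc * (g' i x - c i), ⟨_, fun x => rfl⟩, v (Fin.last n),
        fun x => ?_⟩
      rw [hf, Fin.sum_univ_castSucc]
      simp

theorem Matrix.exists_rank_factorization {X Y : Type*} [Fintype X] [Fintype Y]
    (M : Matrix X Y ℝ) :
    ∃ (g : Fin M.rank → X → ℝ) (v : Y → Fin M.rank → ℝ), ∀ x y, M x y = ∑ i, v y i * g i x := by
  classical
  let B : Module.Basis (Fin M.rank) ℝ (LinearMap.range M.mulVecLin) := Module.finBasis _ _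
  refine ⟨fun i => B i, fun y => B.repr ⟨M.mulVecLin (Pi.single y 1), LinearMap.mem_range_self _ _⟩,
    fun x y => ?_⟩
  have h := congrArg (fun u : LinearMap.range M.mulVecLin => (u : X → ℝ) x)
    (B.sum_repr ⟨M.mulVecLin (Pi.single y 1), LinearMap.mem_range_self _ _⟩)
  simp only [Submodule.coe_sum, Submodule.coe_smul, Finset.sum_apply, Pi.smul_apply,
    smul_eq_mul, Matrix.mulVecLin_apply, Matrix.mulVec_single_one, Matrix.col_apply] at h
  simpa using h.symm

/-- Pigeonhole: if every column is constant on one of `N` given row sets, then some row set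
carries a monochromatic rectangle with a `1 / (2 * N)` fraction of the columns. -/
theorem exists_monochromatic_of_cells {X Y : Type*} [Fintype Y] (F : Matrix X Y ℝ)
    (L : List (Finset X)) (hL : 0 < L.length)
    (h : ∀ y, ∃ P ∈ L, (∀ x ∈ P, F x y = 1) ∨ ∀ x ∈ P, F x y = -1) :
    ∃ S ∈ L, ∃ (T : Finset Y) (b : ℝ), (Fintype.card Y : ℝ) / (2 * L.length) ≤ T.card ∧
      ∀ x ∈ S, ∀ y ∈ T, F x y = b := by
  classical
  have h' : ∀ y, ∃ q : Fin L.length × Bool, ∀ x ∈ L.get q.1, F x y = if q.2 then 1 else -1 := by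
    intro y
    obtain ⟨P, hP, hF⟩ := h y
    obtain ⟨i, rfl⟩ := List.get_of_mem hP
    rcases hF with hF | hF
    · exact ⟨(i, true), by simpa using hF⟩
    · exact ⟨(i, false), by simpa using hF⟩
  choose q hq using h'
  have : Nonempty (Fin L.length) := ⟨⟨0, hL⟩⟩
  have hL' : (0 : ℝ) < L.length := by exact_mod_cast hL
  obtain ⟨p, -, hp⟩ := Finset.exists_le_card_fiber_of_nsmul_le_card_of_maps_to
    (s := (Finset.univ : Finset Y)) (t := Finset.univ) (f := q)
    (b := (Fintype.card Y : ℝ) / (2 * L.length)) (fun _ _ => Finset.mem_univ _)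
    Finset.univ_nonempty (by
      simp only [Finset.card_univ, Fintype.card_prod, Fintype.card_fin, Fintype.card_bool,
        nsmul_eq_mul, Nat.cast_mul, Nat.cast_ofNat]
      apply le_of_eq
      field_simp)
  refine ⟨L.get p.1, List.get_mem _ _, _, if p.2 then 1 else -1, hp, fun x hx y hy => ?_⟩
  have hy' : q y = p := by simpa using hy
  subst hy'
  exact hq y x hx

/-- The cells of a sufficiently fine perturbed orthant system are constant in each column. -/
theorem exists_cells_of_rank {X Y : Type*} [Fintype X] [Fintype Y]
    (F : Matrix X Y ℝ) (hF : ∀ x y, F x y = 1 ∨ F x y = -1) (M : Matrix X Y ℝ)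
    (hM : ∀ x y, 0 < F x y * M x y) (m : ℕ) (hm : 0 < m)
    (hX : m * 2 ^ M.rank ≤ Fintype.card X) :
    ∃ L : List (Finset X), L.length = 2 ^ M.rank ∧ (∀ P ∈ L, m ≤ P.card) ∧
      ∀ y, ∃ P ∈ L, (∀ x ∈ P, F x y = 1) ∨ ∀ x ∈ P, F x y = -1 := by
  obtain ⟨g, v, hgv⟩ := M.exists_rank_factorization
  have hV : ∀ y, 0 ≤ ∑ i, |v y i| := fun y => Finset.sum_nonneg fun i _ => abs_nonneg _
  obtain ⟨ε, hε, hεle⟩ := exists_pos_forall_le_of_finite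
    (fun p : X × Y => F p.1 p.2 * M p.1 p.2 / (1 + ∑ i, |v p.2 i|))
    fun p => div_pos (hM _ _) (by linarith [hV p.2])
  obtain ⟨g', c, L, close, sys, len, card⟩ := exists_orthantSystem m hm ε hε _ g hX
  have hsign : ∀ x y, 0 < F x y * ∑ i, v y i * g' i x := by
    intro x y
    have h₁ := hεle (x, y)
    rw [le_div_iff₀ (by linarith [hV y])] at h₁
    have h₂ : |∑ i, v y i * g' i x - M x y| ≤ ε * ∑ i, |v y i| := by
      rw [hgv, ← Finset.sum_sub_distrib, Finset.mul_sum]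
      refine (Finset.abs_sum_le_sum_abs _ _).trans (Finset.sum_le_sum fun i _ => ?_)
      rw [← mul_sub, abs_mul, mul_comm]
      exact mul_le_mul_of_nonneg_right (close i x) (abs_nonneg _)
    rw [abs_le] at h₂
    rcases hF x y with h | h <;> simp only [h] at h₁ ⊢ <;> linarith
  have hsum : ∀ x y, ∑ i, v y i * g' i x = ∑ i, v y i * (g' i x - c i) + ∑ i, v y i * c i := by
    intro x y
    rw [← Finset.sum_add_distrib]
    exact Finset.sum_congr rfl fun i _ => by ring
  refine ⟨L, len, card, fun y => ?_⟩
  rcases le_total 0 (∑ i, v y i * c i) with hc | hc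
  · obtain ⟨P, hP, h⟩ := sys.exists_nonneg _ ⟨v y, fun x => rfl⟩
    refine ⟨P, hP, Or.inl fun x hx => (hF x y).resolve_right fun hneg => ?_⟩
    have := hsign x y
    rw [hsum, hneg] at this
    linarith [h x hx]
  · obtain ⟨P, hP, h⟩ := sys.exists_nonneg _ ⟨fun i => -v y i, fun x => rfl⟩
    refine ⟨P, hP, Or.inr fun x hx => (hF x y).resolve_left fun hpos => ?_⟩
    have := hsign x y
    have h' := h x hx
    simp only [neg_mul, Finset.sum_neg_distrib] at h'
    rw [hsum, hpos] at this
    linarith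

/-- Every sign matrix of sign-rank `d` contains a monochromatic rectangle of dimensions
at least `|X|/2^{d+1}` by `|Y|/2^{d+1}`. -/
theorem exists_large_monochromatic_rectangle_of_signRank {X Y : Type*} [Fintype X] [Fintype Y]
    (F : Matrix X Y ℝ) (hF : ∀ x y, F x y = 1 ∨ F x y = -1)
    (d : ℕ) (hd : signRank F = d) :
    ∃ (S : Finset X) (T : Finset Y) (b : ℝ),
      (Fintype.card X : ℝ) / 2 ^ (d + 1) ≤ S.card ∧
      (Fintype.card Y : ℝ) / 2 ^ (d + 1) ≤ T.card ∧
      ∀ x ∈ S, ∀ y ∈ T, F x y = b := by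
  have hne : {r : ℕ | ∃ M : Matrix X Y ℝ, (∀ x y, 0 < F x y * M x y) ∧ M.rank ≤ r}.Nonempty :=
    ⟨F.rank, F, fun x y => by rcases hF x y with h | h <;> norm_num [h], le_rfl⟩
  obtain ⟨M, hM, hrank⟩ := Nat.sInf_mem hne
  have hrank' : M.rank ≤ d := hrank.trans hd.le
  have hpow : 2 ^ M.rank ≤ 2 ^ d := Nat.pow_le_pow_right two_pos hrank'
  have hpowR : (2 : ℝ) ^ M.rank ≤ 2 ^ d := by exact_mod_cast hpow
  have hone : (1 : ℝ) ≤ 2 ^ d := one_le_pow₀ one_le_two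
  rcases lt_or_ge (Fintype.card X) (2 ^ d) with hX | hX
  · cases isEmpty_or_nonempty X
    · refine ⟨∅, Finset.univ, 1, by simp, ?_, by simp⟩
      exact div_le_self (Nat.cast_nonneg _) (one_le_pow₀ one_le_two)
    · obtain ⟨x₀⟩ := ‹Nonempty X›
      obtain ⟨S, hS, T, b, hT, hST⟩ := exists_monochromatic_of_cells F [{x₀}] (by simp)
        fun y => ⟨{x₀}, by simp, by simpa using hF x₀ y⟩
      obtain rfl : S = {x₀} := by simpa using hS
      refine ⟨{x₀}, T, b, ?_, le_trans ?_ hT, hST⟩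
      · have hXR : (Fintype.card X : ℝ) < 2 ^ d := by exact_mod_cast hX
        rw [div_le_iff₀ (by positivity), Finset.card_singleton, pow_succ]
        push_cast
        linarith
      · refine div_le_div_of_nonneg_left (Nat.cast_nonneg _) (by simp) ?_
        rw [pow_succ]
        simp
        linarith
  · have hm : 0 < Fintype.card X / 2 ^ d := Nat.div_pos hX (by positivity)
    obtain ⟨L, len, card, hL⟩ := exists_cells_of_rank F hF M hM _ hm
      ((Nat.mul_le_mul_left _ hpow).trans (Nat.div_mul_le_self _ _))
    obtain ⟨S, hS, T, b, hT, hST⟩ := exists_monochromatic_of_cells F L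
      (by rw [len]; positivity) hL
    refine ⟨S, T, b, ?_, le_trans ?_ hT, hST⟩
    · have h₁ : Fintype.card X < 2 ^ d * (Fintype.card X / 2 ^ d + 1) :=
        Nat.lt_mul_div_succ _ (by positivity)
      have h₂ : Fintype.card X ≤ S.card * 2 ^ (d + 1) := by
        have h₃ := card S hS
        rw [pow_succ]
        nlinarith [Nat.mul_le_mul_left (2 ^ d) h₃, Nat.mul_le_mul_left (2 ^ d) hm]
      rw [div_le_iff₀ (by positivity)]
      exact_mod_cast h₂
    · rw [len]
      refine div_le_div_of_nonneg_left (Nat.cast_nonneg _) (by positivity) ?_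
      rw [pow_succ]
      push_cast
      linarith
end

section
/- There exists a constant c > 0 such that for every sufficiently large m there is an m × m sign matrix A with the following two properties: (1) for every pair of probability measures μ₁, μ₂ on the rows and columns of A, there exists a monochromatic rectangle S×T of A with μ₁(S)·μ₂(T) ≥ 2^{−15} (i.e., wrect(A)^{−1} ≤ 2^{15}); and (2) rank_±(A) ≥ c·m^{1/3}/log m. -/
open scoped BigOperators

lemma MvPolynomial.hasDerivAt_eval_update {σ : Type*} [Fintype σ] [DecidableEq σ]
    (x : σ → ℝ) (k : σ) (p : MvPolynomial σ ℝ) :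
    HasDerivAt (fun t => eval (Function.update x k t) p) (eval x (pderiv k p)) (x k) := by
  induction p using MvPolynomial.induction_on with
  | C a => simpa using hasDerivAt_const (x k) a
  | add p q hp hq => simpa only [map_add] using! hp.add hq
  | mul_X p i hp =>
    have hX : HasDerivAt (fun t => Function.update x k t i) (Pi.single (M := fun _ => ℝ) k 1 i)
        (x k) := (hasDerivAt_pi.1 (hasDerivAt_update x k (x k))) i
    have h := hp.mul hX
    simp only [Function.update_eq_self] at h
    have hd : eval x (pderiv k (p * X i)) = eval x (pderiv k p) * x i +
        eval x p * Pi.single (M := fun _ => ℝ) k 1 i := by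
      by_cases hik : i = k
      · subst hik; simp; ring
      · simp [pderiv_X_of_ne hik, hik, mul_comm]
    rw [hd]
    simpa only [map_mul, eval_X] using! h

lemma MvPolynomial.exists_abs_eval_le {σ : Type*} [Fintype σ] (p : MvPolynomial σ ℝ) :
    ∃ C : ℝ, ∃ d : ℕ, 0 ≤ C ∧ ∀ x : σ → ℝ, |eval x p| ≤ C * (1 + ‖x‖) ^ d := by
  induction p using MvPolynomial.induction_on with
  | C a => exact ⟨|a|, 0, abs_nonneg a, by simp⟩
  | add p q hp hq =>
    obtain ⟨C, d, hC, hp⟩ := hp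
    obtain ⟨C', d', hC', hq⟩ := hq
    refine ⟨C + C', max d d', by positivity, fun x => ?_⟩
    have h1 : 1 ≤ 1 + ‖x‖ := by simp
    calc |eval x (p + q)| ≤ |eval x p| + |eval x q| := by rw [map_add]; exact abs_add_le _ _
      _ ≤ C * (1 + ‖x‖) ^ d + C' * (1 + ‖x‖) ^ d' := add_le_add (hp x) (hq x)
      _ ≤ C * (1 + ‖x‖) ^ max d d' + C' * (1 + ‖x‖) ^ max d d' := by
        gcongr
        · exact le_max_left _ _
        · exact le_max_right _ _
      _ = _ := by ring
  | mul_X p i hp =>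
    obtain ⟨C, d, hC, hp⟩ := hp
    refine ⟨C, d + 1, hC, fun x => ?_⟩
    rw [map_mul, eval_X, abs_mul, pow_succ, ← mul_assoc]
    gcongr
    · exact hp x
    · exact (norm_le_pi_norm x i).trans (by simp)

open Filter in
lemma MvPolynomial.tendsto_eval_sq_mul_exp_neg {σ : Type*} [Fintype σ] (p : MvPolynomial σ ℝ)
    (c : σ → ℝ) :
    Tendsto (fun x : σ → ℝ => eval x p ^ 2 * Real.exp (-∑ k, (x k + c k) ^ 2))
      (cocompact (σ → ℝ)) (nhds 0) := by
  obtain ⟨C, d, hC, hp⟩ := p.exists_abs_eval_le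
  have hnorm : Tendsto (fun x : σ → ℝ => ‖x + c‖) (cocompact _) atTop := by
    refine tendsto_atTop_mono (fun x => ?_)
      (tendsto_atTop_add_const_right _ (-‖c‖) (tendsto_norm_cocompact_atTop (E := σ → ℝ)))
    have := norm_sub_le (x + c) c
    simp only [add_sub_cancel_right] at this
    linarith
  have key : Tendsto (fun s : ℝ => (C * (2 + ‖c‖) ^ d) ^ 2 * ((s ^ 2) ^ d * Real.exp (-(s ^ 2))))
      atTop (nhds 0) := by
    simpa using ((Real.tendsto_pow_mul_exp_neg_atTop_nhds_zero d).comp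
      (tendsto_pow_atTop (two_ne_zero))).const_mul ((C * (2 + ‖c‖) ^ d) ^ 2)
  refine squeeze_zero' (Eventually.of_forall fun x => by positivity) ?_ (key.comp hnorm)
  filter_upwards [hnorm.eventually_ge_atTop 1] with x hx
  have h1 : 1 + ‖x‖ ≤ (2 + ‖c‖) * ‖x + c‖ := by
    have := norm_sub_le (x + c) c
    simp only [add_sub_cancel_right] at this
    nlinarith [norm_nonneg c]
  have h2 : |eval x p| ≤ C * (2 + ‖c‖) ^ d * ‖x + c‖ ^ d := by
    rw [mul_assoc, ← mul_pow]
    exact (hp x).trans (by gcongr)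
  have h3 : eval x p ^ 2 ≤ (C * (2 + ‖c‖) ^ d) ^ 2 * (‖x + c‖ ^ 2) ^ d := by
    rw [← sq_abs, ← pow_mul, mul_comm 2 d, pow_mul, ← mul_pow]
    gcongr
  have h4 : ‖x + c‖ ^ 2 ≤ ∑ k, (x k + c k) ^ 2 := by
    by_cases hσ : Nonempty σ
    · obtain ⟨k, hk⟩ := Finite.exists_max (fun k => ‖(x + c) k‖)
      have : ‖x + c‖ ≤ ‖(x + c) k‖ := (pi_norm_le_iff_of_nonneg (norm_nonneg _)).2 hk
      calc ‖x + c‖ ^ 2 ≤ ‖(x + c) k‖ ^ 2 := by gcongr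
        _ = (x k + c k) ^ 2 := by simp
        _ ≤ _ := Finset.single_le_sum (f := fun k => (x k + c k) ^ 2)
          (fun _ _ => sq_nonneg _) (Finset.mem_univ k)
    · rw [not_nonempty_iff] at hσ
      simp [Subsingleton.elim (x + c) 0]
  simp only [Function.comp]
  rw [← mul_assoc]
  gcongr

/-- Each cell of the complement of the zero sets of finitely many polynomials contains solutions
of all the systems `∂Q/∂x_k - x_k Q = c_k Q`, where `Q` is the product of the polynomials. -/
lemma MvPolynomial.exists_critical_point {σ ι : Type*} [Fintype σ] [Fintype ι]
    (p : ι → MvPolynomial σ ℝ) (z : σ → ℝ) (hz : ∀ i, eval z (p i) ≠ 0) (c : σ → ℝ) :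
    ∃ x : σ → ℝ, (∀ i, 0 < eval z (p i) * eval x (p i)) ∧
      ∀ k, eval x (pderiv k (∏ i, p i) - X k * ∏ i, p i) = c k * eval x (∏ i, p i) := by
  classical
  set Q := ∏ i, p i with hQ
  set R : MvPolynomial σ ℝ := ∑ k, (X k + C (c k)) ^ 2 with hR
  have hRe : ∀ x : σ → ℝ, eval x R = ∑ k, (x k + c k) ^ 2 := fun x => by simp [hR]
  set h : (σ → ℝ) → ℝ := fun x => eval x Q ^ 2 * Real.exp (-eval x R) with hh
  have hcont : Continuous h := by
    have := MvPolynomial.continuous_eval Q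
    have := MvPolynomial.continuous_eval R
    fun_prop
  set K : Set (σ → ℝ) := {x | ∀ i, 0 ≤ eval z (p i) * eval x (p i)} with hK
  have hKc : IsClosed K := by
    simp only [hK, Set.ofPred_forall]
    exact isClosed_iInter fun i =>
      isClosed_le continuous_const (continuous_const.mul (MvPolynomial.continuous_eval (p i)))
  have hzQ : eval z Q ≠ 0 := by
    rw [hQ, map_prod]; exact Finset.prod_ne_zero_iff.2 fun i _ => hz i
  have hpos : 0 < h z := by simp only [hh]; positivity
  have htend := Q.tendsto_eval_sq_mul_exp_neg c
  simp only [← hRe] at htend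
  obtain ⟨x, hxK, hx⟩ := hcont.continuousOn.exists_isMaxOn' hKc
    (show z ∈ K from fun i => mul_self_nonneg _)
    (((htend.eventually_lt_const hpos).mono fun _ hy => le_of_lt hy).filter_mono inf_le_left)
  have hxpos : 0 < h x := hpos.trans_le (hx (show z ∈ K from fun i => mul_self_nonneg _))
  have hxQ : eval x Q ≠ 0 := by
    intro h0; simp [hh, h0] at hxpos
  have hxp : ∀ i, eval x (p i) ≠ 0 := by
    rw [hQ, map_prod] at hxQ
    exact fun i => Finset.prod_ne_zero_iff.1 hxQ i (Finset.mem_univ i)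
  have hcell : ∀ i, 0 < eval z (p i) * eval x (p i) := fun i =>
    lt_of_le_of_ne (hxK i) (mul_ne_zero (hz i) (hxp i)).symm
  refine ⟨x, hcell, fun k => ?_⟩
  have hKn : K ∈ nhds x := by
    have : ∀ᶠ y in nhds x, ∀ i, 0 < eval z (p i) * eval y (p i) :=
      Filter.eventually_all.2 fun i =>
        ((continuous_const.mul (MvPolynomial.continuous_eval (p i))).tendsto x).eventually_const_lt
          (hcell i)
    exact this.mono fun y hy i => (hy i).le
  have hloc : IsLocalMax h x := hx.isLocalMax hKn
  have hup : Filter.Tendsto (fun t => Function.update x k t) (nhds (x k)) (nhds x) := by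
    have : Continuous (fun t => Function.update x k t) := by fun_prop
    simpa using this.tendsto (x k)
  have hloc' : IsLocalMax (fun t => h (Function.update x k t)) (x k) := by
    have := hup.eventually hloc
    simpa [IsLocalMax, IsMaxFilter] using this
  have hd := ((Q.hasDerivAt_eval_update x k).pow 2).mul (R.hasDerivAt_eval_update x k).neg.exp
  have h0 := hloc'.hasDerivAt_eq_zero hd
  have hRd : eval x (pderiv k R) = 2 * (x k + c k) := by
    simp [hR, pderiv_X, Pi.single_apply, Derivation.leibniz_pow]
    ring
  rw [hRd] at h0
  simp only [Function.update_eq_self] at h0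
  have h1 : 2 * eval x Q * Real.exp (-eval x R) *
      (eval x (pderiv k Q) - (x k + c k) * eval x Q) = 0 := by
    rw [← h0]; simp; ring
  have h2 := (mul_eq_zero.1 h1).resolve_left (by positivity)
  simp only [map_sub, map_mul, eval_X]
  linarith

lemma MvPolynomial.finrank_restrictDegree_le {σ : Type*} [Fintype σ] (E : ℕ) :
    Module.finrank ℝ (restrictDegree σ ℝ E) ≤ (E + 1) ^ Fintype.card σ := by
  classical
  have hinj : Function.Injective (fun (n : {n : σ →₀ ℕ | ∀ i, n i ≤ E}) (i : σ) =>
      (⟨n.1 i, Nat.lt_succ_of_le (n.2 i)⟩ : Fin (E + 1))) := by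
    intro a b hab
    ext i
    simpa using congrFun hab i
  have : Fintype {n : σ →₀ ℕ | ∀ i, n i ≤ E} := Fintype.ofInjective _ hinj
  have := Module.finrank_eq_card_basis (basisRestrictSupport ℝ {n : σ →₀ ℕ | ∀ i, n i ≤ E})
  calc _ = Fintype.card {n : σ →₀ ℕ | ∀ i, n i ≤ E} := this
    _ ≤ Fintype.card (σ → Fin (E + 1)) := Fintype.card_le_of_injective _ hinj
    _ = _ := by simp

/-- Points separated by polynomials of total degree at most `E` impose independent conditions,
so there are at most `(E + 1) ^ n` of them. -/
lemma MvPolynomial.card_le_of_separating {σ J : Type*} [Fintype σ] [Fintype J] (E : ℕ)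
    (x : J → σ → ℝ) (F : J → MvPolynomial σ ℝ) (hF : ∀ j, (F j).totalDegree ≤ E)
    (hdiag : ∀ j, eval (x j) (F j) ≠ 0) (hoff : ∀ j j', j ≠ j' → eval (x j') (F j) = 0) :
    Fintype.card J ≤ (E + 1) ^ Fintype.card σ := by
  classical
  have hmem : ∀ j, F j ∈ restrictDegree σ ℝ E := fun j =>
    restrictTotalDegree_le_restrictDegree σ ℝ E ((mem_restrictTotalDegree σ E (F j)).2 (hF j))
  have hli : LinearIndependent ℝ (fun j => (⟨F j, hmem j⟩ : restrictDegree σ ℝ E)) := by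
    rw [Fintype.linearIndependent_iff]
    intro g hg j
    have h1 : ∑ i, g i • F i = 0 := by simpa using congrArg Subtype.val hg
    have h2 := congrArg (eval (x j)) h1
    rw [map_sum, Finset.sum_eq_single j] at h2
    · simpa [smul_eval, hdiag j] using h2
    · intro i _ hij; simp [smul_eval, hoff i j hij]
    · simp
  exact hli.fintype_card_le_finrank.trans (finrank_restrictDegree_le E)

lemma MvPolynomial.totalDegree_pderiv_le {σ : Type*} (k : σ) (p : MvPolynomial σ ℝ) :
    (pderiv k p).totalDegree ≤ p.totalDegree := by
  classical
  refine Finset.sup_le fun s hs => ?_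
  have hs' : s + Finsupp.single k 1 ∈ p.support := by
    rw [mem_support_iff] at hs ⊢
    rw [coeff_pderiv] at hs
    exact left_ne_zero_of_mul hs
  have h := le_totalDegree hs'
  rw [Finsupp.sum_add_index' (fun _ => rfl) (fun _ _ _ => rfl)] at h
  omega

/-- A weak form of Warren's theorem: `J` points lying in pairwise distinct sign cells of
polynomials `p i` of degree at most `d` number at most `(n (M d + 1) + 1) ^ n`. -/
theorem MvPolynomial.card_sign_cells_le {σ ι J : Type*} [Fintype σ] [Fintype ι] [Fintype J] (d : ℕ)
    (p : ι → MvPolynomial σ ℝ) (hp : ∀ i, (p i).totalDegree ≤ d) (z : J → σ → ℝ)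
    (hz : ∀ j i, eval (z j) (p i) ≠ 0)
    (hsep : ∀ j j', j ≠ j' → ∃ i, eval (z j) (p i) * eval (z j') (p i) < 0) :
    Fintype.card J ≤
      (Fintype.card σ * (Fintype.card ι * d + 1) + 1) ^ Fintype.card σ := by
  classical
  set N := Fintype.card J with hN
  rcases Nat.eq_zero_or_pos N with h0 | hNpos
  · simp [h0]
  set n := Fintype.card σ with hn
  set D := Fintype.card ι * d with hD
  set Q := ∏ i, p i with hQ
  set G : σ → MvPolynomial σ ℝ := fun k => pderiv k Q - X k * Q with hG
  have hQd : Q.totalDegree ≤ D := by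
    refine (totalDegree_finsetProd _ _).trans ((Finset.sum_le_sum fun i _ => hp i).trans ?_)
    simp [hD]
  have hGd : ∀ k, (G k).totalDegree ≤ D + 1 := by
    intro k
    refine (totalDegree_sub _ _).trans (max_le ?_ ?_)
    · exact (totalDegree_pderiv_le k Q).trans (by omega)
    · refine (totalDegree_mul _ _).trans ?_
      rw [totalDegree_X]; omega
  choose x hcell hcrit using fun (a : J × (σ → Fin N)) =>
    exists_critical_point p (z a.1) (hz a.1) (fun k => ((a.2 k : ℕ) : ℝ))
  have hxQ : ∀ a, eval (x a) Q ≠ 0 := by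
    intro a
    rw [hQ, map_prod]
    exact Finset.prod_ne_zero_iff.2 fun i _ h => by simpa [h] using hcell a i
  have hne : ∀ j j' c, j ≠ j' → x (j, c) ≠ x (j', c) := by
    intro j j' c hjj hcon
    obtain ⟨i, hi⟩ := hsep j j' hjj
    have h1 := hcell (j, c) i
    have h2 := hcell (j', c) i
    rw [hcon] at h1
    simp only at h1 h2
    have h3 := mul_pos h1 h2
    nlinarith [sq_nonneg (eval (x (j', c)) (p i))]
  have hlin : ∀ j j' c, ∃ P : MvPolynomial σ ℝ, P.totalDegree ≤ 1 ∧ eval (x (j', c)) P = 0 ∧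
      (j ≠ j' → eval (x (j, c)) P ≠ 0) := by
    intro j j' c
    by_cases hjj : j = j'
    · exact ⟨0, by simp, by simp, fun h => absurd hjj h⟩
    · obtain ⟨k, hk⟩ := Function.ne_iff.1 (hne j j' c hjj)
      refine ⟨X k - C (x (j', c) k), (totalDegree_sub _ _).trans ?_, by simp, fun _ => ?_⟩
      · simp [totalDegree_X, totalDegree_C]
      · simpa [sub_eq_zero] using hk
  choose P hPd hPz hPn using hlin
  set F : J × (σ → Fin N) → MvPolynomial σ ℝ := fun a =>
    (∏ k, ∏ g ∈ Finset.univ.erase (a.2 k), (G k - C ((g : ℕ) : ℝ) * Q)) *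
      ∏ j ∈ Finset.univ.erase a.1, P a.1 j a.2 with hF
  have hG' : ∀ a k g, eval (x a) (G k - C ((g : ℕ) : ℝ) * Q) =
      (((a.2 k : ℕ) : ℝ) - (g : ℕ)) * eval (x a) Q := by
    intro a k g
    have := hcrit a k
    rw [map_sub, this, map_mul, eval_C]; ring
  have key := card_le_of_separating (n * (N - 1) * (D + 1) + (N - 1)) x F ?_ ?_ ?_
  · rw [Fintype.card_prod, Fintype.card_fun, Fintype.card_fin, ← hN, ← hn] at key
    have hE : n * (N - 1) * (D + 1) + (N - 1) + 1 ≤ N * (n * (D + 1) + 1) := by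
      obtain ⟨t, ht⟩ : ∃ t, N = t + 1 := ⟨N - 1, by omega⟩
      rw [ht, Nat.add_sub_cancel]
      nlinarith [Nat.zero_le (n * (D + 1))]
    have h1 : N * N ^ n ≤ N ^ n * (n * (D + 1) + 1) ^ n := by
      rw [← mul_pow]
      exact key.trans (Nat.pow_le_pow_left hE n)
    rw [mul_comm] at h1
    exact Nat.le_of_mul_le_mul_left h1 (by positivity)
  · intro a
    refine (totalDegree_mul _ _).trans (add_le_add ?_ ?_)
    · refine (totalDegree_finsetProd _ _).trans ?_
      rw [mul_assoc, hn, ← Finset.card_univ, ← smul_eq_mul]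
      refine Finset.sum_le_card_nsmul _ _ _ fun k _ => ?_
      refine (totalDegree_finsetProd _ _).trans ?_
      refine (Finset.sum_le_card_nsmul _ _ (D + 1) fun g _ => ?_).trans ?_
      · refine (totalDegree_sub _ _).trans (max_le (hGd k) ?_)
        refine (totalDegree_mul _ _).trans ?_
        rw [totalDegree_C]; omega
      · simp
    · refine (totalDegree_finsetProd _ _).trans ?_
      refine (Finset.sum_le_card_nsmul _ _ 1 fun j _ => hPd _ _ _).trans ?_
      simp [hN]
  · rintro ⟨j, c⟩
    simp only [hF, map_mul, map_prod]
    refine mul_ne_zero (Finset.prod_ne_zero_iff.2 fun k _ => Finset.prod_ne_zero_iff.2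
      fun g hg => ?_) (Finset.prod_ne_zero_iff.2 fun j' hj' =>
        hPn j j' c (Finset.ne_of_mem_erase hj').symm)
    · rw [hG']
      refine mul_ne_zero (sub_ne_zero.2 fun h => (Finset.ne_of_mem_erase hg) ?_) (hxQ _)
      exact (Fin.ext (by exact_mod_cast h)).symm
  · rintro ⟨j, c⟩ ⟨j', c'⟩ hne
    simp only [hF, map_mul, map_prod]
    by_cases hc : c = c'
    · subst hc
      have hj : j' ≠ j := fun h => hne (by rw [h])
      exact mul_eq_zero_of_right _
        (Finset.prod_eq_zero (Finset.mem_erase.2 ⟨hj, Finset.mem_univ j'⟩) (hPz j j' c))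
    · obtain ⟨k, hk⟩ := Function.ne_iff.1 hc
      refine mul_eq_zero_of_left (Finset.prod_eq_zero (Finset.mem_univ k)
        (Finset.prod_eq_zero (Finset.mem_erase.2 ⟨hk.symm, Finset.mem_univ (c' k)⟩) ?_)) _
      rw [hG']; simp

/-- Existence of a weighted median. -/
lemma Finset.exists_weighted_median {X α : Type*} [LinearOrder α] (s : Finset X) (hs : s.Nonempty)
    (μ : X → ℝ) (hμ : ∀ x, 0 ≤ μ x) (f : X → α) :
    ∃ t : α, (∑ x ∈ s, μ x) / 2 ≤ ∑ x ∈ s with f x ≤ t, μ x ∧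
      (∑ x ∈ s, μ x) / 2 ≤ ∑ x ∈ s with t ≤ f x, μ x := by
  classical
  have hW : 0 ≤ ∑ x ∈ s, μ x := Finset.sum_nonneg fun x _ => hμ x
  have hne : {x ∈ s | (∑ y ∈ s, μ y) / 2 ≤ ∑ y ∈ s with f y ≤ f x, μ y}.Nonempty := by
    obtain ⟨x, hx, hmax⟩ := s.exists_max_image f hs
    refine ⟨x, Finset.mem_filter.2 ⟨hx, ?_⟩⟩
    rw [Finset.filter_true_of_mem hmax]
    linarith
  obtain ⟨x, hx, hmin⟩ := Finset.exists_min_image _ f hne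
  rw [Finset.mem_filter] at hx
  refine ⟨f x, hx.2, ?_⟩
  have hlt : ∑ y ∈ s with f y < f x, μ y ≤ (∑ y ∈ s, μ y) / 2 := by
    by_contra! hcon
    have hne' : {y ∈ s | f y < f x}.Nonempty := by
      rw [Finset.nonempty_iff_ne_empty]
      intro h
      rw [h, Finset.sum_empty] at hcon
      linarith
    obtain ⟨y, hy, hmax⟩ := Finset.exists_max_image _ f hne'
    rw [Finset.mem_filter] at hy
    have hle : ∑ z ∈ s with f z < f x, μ z ≤ ∑ z ∈ s with f z ≤ f y, μ z := by
      refine Finset.sum_le_sum_of_subset_of_nonneg (fun z hz => ?_) fun z _ _ => hμ z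
      exact Finset.mem_filter.2 ⟨(Finset.mem_filter.1 hz).1, hmax z hz⟩
    exact (hmin y (Finset.mem_filter.2 ⟨hy.1, hcon.le.trans hle⟩)).not_gt hy.2
  have hsplit := Finset.sum_filter_add_sum_filter_not s (fun y => f y < f x) μ
  simp only [not_lt] at hsplit
  linarith

/-- Removing at most one point of weight at most `δ`. -/
lemma Finset.sub_le_sum_filter_ne {X α : Type*} [DecidableEq α] (s : Finset X) (μ : X → ℝ) {δ : ℝ}
    (hδ : 0 ≤ δ) (hμδ : ∀ x, μ x ≤ δ) (f : X → α) (hf : Function.Injective f) (a : α) :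
    ∑ x ∈ s, μ x - δ ≤ ∑ x ∈ s with f x ≠ a, μ x := by
  have hsplit := Finset.sum_filter_add_sum_filter_not s (fun x => f x ≠ a) μ
  have hsmall : ∑ x ∈ s with ¬ f x ≠ a, μ x ≤ δ := by
    rcases Finset.eq_empty_or_nonempty {x ∈ s | ¬ f x ≠ a} with h | ⟨y, hy⟩
    · rw [h, Finset.sum_empty]; exact hδ
    · have h1 : {x ∈ s | ¬ f x ≠ a} ⊆ {y} := by
        intro x hx
        simp only [Finset.mem_filter, not_not] at hx hy
        exact Finset.mem_singleton.2 (hf (hx.2.trans hy.2.symm))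
      rw [(Finset.Nonempty.subset_singleton_iff ⟨y, hy⟩).1 h1, Finset.sum_singleton]
      exact hμδ y
  linarith

/-- A row of large weight yields a monochromatic rectangle of large weight. -/
lemma exists_rectangle_of_row {X Y : Type*} [Fintype Y] (A : X → Y → ℝ)
    (hA : ∀ x y, A x y = 1 ∨ A x y = -1) (μ₁ : X → ℝ) (μ₂ : Y → ℝ)
    (h2' : ∑ y, μ₂ y = 1) (x : X) (hx : 1 / 8 ≤ μ₁ x) :
    ∃ (T : Finset Y) (b : ℝ), (∀ y ∈ T, A x y = b) ∧ 1 / 16 ≤ μ₁ x * ∑ y ∈ T, μ₂ y := by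
  classical
  have hsplit := Finset.sum_filter_add_sum_filter_not Finset.univ (fun y => A x y = 1) μ₂
  rw [h2'] at hsplit
  by_cases h : 1 / 2 ≤ ∑ y with A x y = 1, μ₂ y
  · refine ⟨Finset.univ.filter fun y => A x y = 1, 1, fun y hy => (Finset.mem_filter.1 hy).2, ?_⟩
    nlinarith
  · refine ⟨Finset.univ.filter fun y => ¬ A x y = 1, -1,
      fun y hy => (hA x y).resolve_left (Finset.mem_filter.1 hy).2, ?_⟩
    nlinarith

/-- Large sets of points and of lines such that every line passes weakly on a prescribed side of
every point contain large parts without incidences. Here `u` is the height of a point relative to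
the line of slope `s` through a base point on the vertical line at `t`, and `v` is the height of a
line at `t`. -/
lemma exists_rectangle_of_separated {X Y : Type*} (A : X → Y → ℝ) (P : X → ℤ × ℤ) (L : Y → ℤ × ℤ)
    (hP : Function.Injective P) (hL : Function.Injective L)
    (hA : ∀ x y, (P x).2 ≠ (L y).1 * (P x).1 + (L y).2 → A x y = 1)
    (μ₁ : X → ℝ) (μ₂ : Y → ℝ) (h1 : ∀ x, μ₁ x ≤ 1 / 8) (h2 : ∀ y, μ₂ y ≤ 1 / 8)
    (t s m : ℤ) (S : Finset X) (T : Finset Y)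
    (hS : 1 / 4 ≤ ∑ x ∈ S, μ₁ x) (hT : 1 / 4 ≤ ∑ y ∈ T, μ₂ y)
    (hST : ∀ x ∈ S, ∀ y ∈ T,
      ((P x).2 - s * (P x).1 ≤ m ∧ m ≤ ((L y).1 - s) * t + (L y).2 ∧
        0 ≤ ((L y).1 - s) * ((P x).1 - t)) ∨
      (m ≤ (P x).2 - s * (P x).1 ∧ ((L y).1 - s) * t + (L y).2 ≤ m ∧
        ((L y).1 - s) * ((P x).1 - t) ≤ 0)) :
    ∃ (S : Finset X) (T : Finset Y), (∀ x ∈ S, ∀ y ∈ T, A x y = 1) ∧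
      1 / 64 ≤ (∑ x ∈ S, μ₁ x) * (∑ y ∈ T, μ₂ y) := by
  classical
  refine ⟨{x ∈ S | P x ≠ (t, s * t + m)}, {y ∈ T | L y ≠ (s, m)}, fun x hx y hy => ?_, ?_⟩
  · rw [Finset.mem_filter] at hx hy
    refine hA x y fun hinc => ?_
    have hcase := hST x hx.1 y hy.1
    have hkey : ((P x).2 - s * (P x).1) - (((L y).1 - s) * t + (L y).2) =
        ((L y).1 - s) * ((P x).1 - t) := by rw [hinc]; ring
    have hu : (P x).2 - s * (P x).1 = m := by rcases hcase with h | h <;> linarith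
    have hv : ((L y).1 - s) * t + (L y).2 = m := by rcases hcase with h | h <;> linarith
    have hz : ((L y).1 - s) * ((P x).1 - t) = 0 := by linarith
    rcases mul_eq_zero.1 hz with h | h
    · refine hy.2 (Prod.ext (by simp only; linarith) ?_)
      rw [h] at hv
      simp only; linarith
    · have hxt : (P x).1 = t := by linarith
      refine hx.2 (Prod.ext hxt ?_)
      rw [hxt] at hu
      simp only; linarith
  · have := S.sub_le_sum_filter_ne μ₁ (by norm_num) h1 P hP (t, s * t + m)
    have := T.sub_le_sum_filter_ne μ₂ (by norm_num) h2 L hL (s, m)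
    nlinarith

/-- A sign matrix which is `1` outside of a point-line incidence relation has a monochromatic
rectangle of weight at least `1 / 64` with respect to each product probability measure. -/
theorem exists_rectangle_of_incidence {X Y : Type*} [Fintype X] [Fintype Y] (A : X → Y → ℝ)
    (P : X → ℤ × ℤ) (L : Y → ℤ × ℤ) (hP : Function.Injective P) (hL : Function.Injective L)
    (hpm : ∀ x y, A x y = 1 ∨ A x y = -1)
    (hA : ∀ x y, (P x).2 ≠ (L y).1 * (P x).1 + (L y).2 → A x y = 1)
    (μ₁ : X → ℝ) (μ₂ : Y → ℝ) (h1 : ∀ x, 0 ≤ μ₁ x) (h1' : ∑ x, μ₁ x = 1)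
    (h2 : ∀ y, 0 ≤ μ₂ y) (h2' : ∑ y, μ₂ y = 1) :
    ∃ (S : Finset X) (T : Finset Y) (b : ℝ), (∀ x ∈ S, ∀ y ∈ T, A x y = b) ∧
      1 / 64 ≤ (∑ x ∈ S, μ₁ x) * (∑ y ∈ T, μ₂ y) := by
  classical
  by_cases hrow : ∃ x, 1 / 8 ≤ μ₁ x
  · obtain ⟨x, hx⟩ := hrow
    obtain ⟨T, b, hT, hw⟩ := exists_rectangle_of_row A hpm μ₁ μ₂ h2' x hx
    exact ⟨{x}, T, b, by simpa using hT, by rw [Finset.sum_singleton]; linarith⟩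
  by_cases hcol : ∃ y, 1 / 8 ≤ μ₂ y
  · obtain ⟨y, hy⟩ := hcol
    obtain ⟨S, b, hS, hw⟩ :=
      exists_rectangle_of_row (fun y x => A x y) (fun y x => hpm x y) μ₂ μ₁ h1' y hy
    exact ⟨S, {y}, b, by simpa using hS, by rw [Finset.sum_singleton, mul_comm]; linarith⟩
  push Not at hrow hcol
  have hhalf : (0 : ℝ) < 1 / 2 := by norm_num
  have hquarter : ∀ {a b : ℝ}, 1 / 2 ≤ a → a / 2 ≤ b → 1 / 4 ≤ b := by
    intro a b ha hb
    linarith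
  have hX : (Finset.univ : Finset X).Nonempty :=
    Finset.nonempty_of_sum_ne_zero (h1'.trans_ne one_ne_zero)
  have hY : (Finset.univ : Finset Y).Nonempty :=
    Finset.nonempty_of_sum_ne_zero (h2'.trans_ne one_ne_zero)
  obtain ⟨t, htL, htR⟩ := Finset.univ.exists_weighted_median hX μ₁ h1 (fun x => (P x).1)
  obtain ⟨s, hsW, hsH⟩ := Finset.univ.exists_weighted_median hY μ₂ h2 (fun y => (L y).1)
  rw [h1'] at htL htR
  rw [h2'] at hsW hsH
  set u : X → ℤ := fun x => (P x).2 - s * (P x).1 with hu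
  set v : Y → ℤ := fun y => ((L y).1 - s) * t + (L y).2 with hv
  obtain ⟨uL, huL, huL'⟩ := Finset.exists_weighted_median _
    (Finset.nonempty_of_sum_ne_zero (hhalf.trans_le htL).ne') μ₁ h1 u
  obtain ⟨uR, huR, huR'⟩ := Finset.exists_weighted_median _
    (Finset.nonempty_of_sum_ne_zero (hhalf.trans_le htR).ne') μ₁ h1 u
  obtain ⟨vW, hvW, hvW'⟩ := Finset.exists_weighted_median _
    (Finset.nonempty_of_sum_ne_zero (hhalf.trans_le hsW).ne') μ₂ h2 v
  obtain ⟨vH, hvH, hvH'⟩ := Finset.exists_weighted_median _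
    (Finset.nonempty_of_sum_ne_zero (hhalf.trans_le hsH).ne') μ₂ h2 v
  have hsep := exists_rectangle_of_separated A P L hP hL hA μ₁ μ₂ (fun x => (hrow x).le)
    (fun y => (hcol y).le) t s
  suffices ∃ (S : Finset X) (T : Finset Y), (∀ x ∈ S, ∀ y ∈ T, A x y = 1) ∧
      1 / 64 ≤ (∑ x ∈ S, μ₁ x) * (∑ y ∈ T, μ₂ y) by
    obtain ⟨S, T, h⟩ := this
    exact ⟨S, T, 1, h⟩
  rcases le_or_gt uR vH with h | hRH
  · refine hsep uR _ _ (hquarter htR huR) (hquarter hsH hvH') fun x hx y hy => Or.inl ?_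
    simp only [Finset.mem_filter, Finset.mem_univ, true_and] at hx hy
    exact ⟨hx.2, h.trans hy.2, mul_nonneg (by linarith) (by linarith)⟩
  rcases le_or_gt vH uL with h | hLH
  · refine hsep uL _ _ (hquarter htL huL') (hquarter hsH hvH) fun x hx y hy => Or.inr ?_
    simp only [Finset.mem_filter, Finset.mem_univ, true_and] at hx hy
    exact ⟨hx.2, hy.2.trans h, mul_nonpos_of_nonneg_of_nonpos (by linarith) (by linarith)⟩
  rcases le_or_gt uL vW with h | hLW
  · refine hsep uL _ _ (hquarter htL huL) (hquarter hsW hvW') fun x hx y hy => Or.inl ?_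
    simp only [Finset.mem_filter, Finset.mem_univ, true_and] at hx hy
    exact ⟨hx.2, h.trans hy.2, mul_nonneg_of_nonpos_of_nonpos (by linarith) (by linarith)⟩
  rcases le_or_gt vW uR with h | hRW
  · refine hsep uR _ _ (hquarter htR huR') (hquarter hsW hvW) fun x hx y hy => Or.inr ?_
    simp only [Finset.mem_filter, Finset.mem_univ, true_and] at hx hy
    exact ⟨hx.2, hy.2.trans h, mul_nonpos_of_nonpos_of_nonneg (by linarith) (by linarith)⟩
  exact absurd (hRH.trans (hRW.trans (hLW.trans hLH))) (lt_irrefl _)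

/-- Rank factorization. -/
lemma Matrix.exists_eq_mul_of_rank_le {X Y : Type*} [Fintype Y] [Finite X]
    (M : Matrix X Y ℝ) {r : ℕ} (h : M.rank ≤ r) :
    ∃ (U : Matrix X (Fin r) ℝ) (V : Matrix (Fin r) Y ℝ), M = U * V := by
  set W := Submodule.span ℝ (Set.range M.col) with hW
  have hWr : Module.finrank ℝ W ≤ r := M.rank_eq_finrank_span_cols ▸ h
  let b := Module.finBasis ℝ W
  let w : Fin r → X → ℝ := fun l =>
    if hl : (l : ℕ) < Module.finrank ℝ W then (b ⟨l, hl⟩ : X → ℝ) else 0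
  have hmem : ∀ j, M.col j ∈ Submodule.span ℝ (Set.range w) := by
    intro j
    have hj : M.col j ∈ W := Submodule.subset_span ⟨j, rfl⟩
    have hsum := congrArg Subtype.val (b.sum_repr ⟨M.col j, hj⟩)
    simp only [Submodule.coe_sum, Submodule.coe_smul] at hsum
    rw [← hsum]
    refine Submodule.sum_mem _ fun l _ => Submodule.smul_mem _ _ (Submodule.subset_span ?_)
    exact ⟨⟨l, l.2.trans_le hWr⟩, by simp [w]⟩
  choose V hV using fun j => (Submodule.mem_span_range_iff_exists_fun ℝ).1 (hmem j)
  refine ⟨Matrix.of fun i l => w l i, Matrix.of fun l j => V j l, ?_⟩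
  ext i j
  have := congrFun (hV j) i
  simp only [Finset.sum_apply, Pi.smul_apply, smul_eq_mul, Matrix.col_apply] at this
  rw [← this, Matrix.mul_apply]
  exact Finset.sum_congr rfl fun l _ => mul_comm _ _

lemma exists_rank_le_of_signRank_le {X Y : Type*} [Fintype X] [Fintype Y] (F : Matrix X Y ℝ)
    (hF : ∀ x y, F x y ≠ 0) {r : ℕ} (h : signRank F ≤ r) :
    ∃ M : Matrix X Y ℝ, (∀ x y, 0 < F x y * M x y) ∧ M.rank ≤ r := by
  have hne : {r : ℕ | ∃ M : Matrix X Y ℝ, (∀ x y, 0 < F x y * M x y) ∧ M.rank ≤ r}.Nonempty :=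
    ⟨F.rank, F, fun x y => mul_self_pos.2 (hF x y), le_rfl⟩
  obtain ⟨M, hM, hr⟩ := Nat.sInf_mem hne
  exact ⟨M, hM, hr.trans h⟩

/-- A family of sign matrices of sign-rank at most `r` which have pairwise distinct restrictions to
a set of positions is small. -/
theorem card_le_of_signRank_le {X Y ι J : Type*} [Fintype X] [Fintype Y] [Fintype ι] [Fintype J]
    (A : J → Matrix X Y ℝ) (hA : ∀ j x y, A j x y ≠ 0) (e : ι → X × Y)
    (hsep : ∀ j j', j ≠ j' → ∃ i, A j (e i).1 (e i).2 * A j' (e i).1 (e i).2 < 0) (r : ℕ)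
    (hr : ∀ j, signRank (A j) ≤ r) :
    Fintype.card J ≤ ((Fintype.card X * r + r * Fintype.card Y) * (Fintype.card ι * 2 + 1) + 1) ^
      (Fintype.card X * r + r * Fintype.card Y) := by
  choose M hM hMr using fun j => exists_rank_le_of_signRank_le (A j) (hA j) (hr j)
  choose U V hUV using fun j => (M j).exists_eq_mul_of_rank_le (hMr j)
  let p : ι → MvPolynomial (X × Fin r ⊕ Fin r × Y) ℝ := fun i =>
    ∑ l, MvPolynomial.X (Sum.inl ((e i).1, l)) * MvPolynomial.X (Sum.inr (l, (e i).2))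
  let z : J → X × Fin r ⊕ Fin r × Y → ℝ := fun j =>
    Sum.elim (fun a => U j a.1 a.2) (fun a => V j a.1 a.2)
  have hpz : ∀ j i, MvPolynomial.eval (z j) (p i) = M j (e i).1 (e i).2 := by
    intro j i
    simp [p, z, hUV j, Matrix.mul_apply]
  have key := MvPolynomial.card_sign_cells_le 2 p ?_ z ?_ ?_
  · simpa using key
  · intro i
    refine MvPolynomial.totalDegree_finsetSum_le fun l _ => ?_
    refine (MvPolynomial.totalDegree_mul _ _).trans ?_
    simp
  · intro j i
    rw [hpz]
    exact right_ne_zero_of_mul (hM j _ _).ne'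
  · intro j j' hjj
    obtain ⟨i, hi⟩ := hsep j j' hjj
    refine ⟨i, ?_⟩
    rw [hpz, hpz]
    have h1 := hM j (e i).1 (e i).2
    have h2 := hM j' (e i).1 (e i).2
    by_contra! hcon
    nlinarith [mul_pos h1 h2]

/-- The grid of width `k`, enumerated row by row. -/
def gridPoint (k i : ℕ) : ℤ × ℤ := ((i % k : ℕ), (i / k : ℕ))

lemma gridPoint_injective (k : ℕ) : Function.Injective (gridPoint k) := by
  intro i j h
  simp only [gridPoint, Prod.mk.injEq, Nat.cast_inj] at h
  rw [← Nat.mod_add_div i k, ← Nat.mod_add_div j k, h.1, h.2]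

/-- The grid spans `k ^ 4` incidences between points `(x, y)` and lines `y = a x + b`. -/
lemma exists_incidences (k m : ℕ) (hm : 2 * k ^ 3 ≤ m) :
    ∃ e : Fin (k ^ 3) × Fin k → Fin m × Fin m, Function.Injective e ∧ ∀ q,
      (gridPoint k (e q).1).2 =
        (gridPoint k (e q).2).1 * (gridPoint k (e q).1).1 + (gridPoint k (e q).2).2 := by
  have hbound : ∀ q : Fin (k ^ 3) × Fin k,
      (q.2 : ℕ) + k * ((q.1 % k : ℕ) * q.2 + (q.1 / k : ℕ)) < m := by
    rintro ⟨j, x⟩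
    have hk : 0 < k := x.pos
    have h1 : (j : ℕ) / k < k ^ 2 := by
      rw [Nat.div_lt_iff_lt_mul hk]
      exact j.2.trans_eq (by ring)
    have h2 : (j : ℕ) % k * x + k ≤ k ^ 2 := by
      have := Nat.mod_lt (j : ℕ) hk
      nlinarith [Nat.mul_le_mul_left ((j : ℕ) % k) x.2.le]
    have h3 : (j : ℕ) % k * x + j / k + 1 ≤ 2 * k ^ 2 := by omega
    have h4 := Nat.mul_le_mul_left k h3
    have h5 : k * (2 * k ^ 2) = 2 * k ^ 3 := by ring
    have := x.2
    rw [mul_add, mul_one] at h4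
    simp only
    omega
  refine ⟨fun q => (⟨_, hbound q⟩, ⟨q.1, q.1.2.trans_le (by omega)⟩), ?_, ?_⟩
  · rintro ⟨j, x⟩ ⟨j', x'⟩ h
    simp only [Prod.mk.injEq, Fin.mk.injEq] at h
    have hj : j = j' := Fin.ext h.2
    have hx := congrArg (· % k) h.1
    simp only [Nat.add_mul_mod_self_left, Nat.mod_eq_of_lt x.2, Nat.mod_eq_of_lt x'.2] at hx
    exact Prod.ext hj (Fin.ext hx)
  · rintro ⟨j, x⟩
    have hk : 0 < k := x.pos
    simp only [gridPoint, Nat.add_mul_mod_self_left, Nat.add_mul_div_left _ _ hk,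
      Nat.mod_eq_of_lt x.2, Nat.div_eq_of_lt x.2, zero_add]
    push_cast
    ring

/-- The sign matrix which is `-1` exactly at the selected positions. -/
noncomputable def selectionMatrix {ι X Y : Type*} (e : ι → X × Y) (f : ι → Bool) : Matrix X Y ℝ :=
  open Classical in fun x y => if ∃ q, e q = (x, y) ∧ f q = true then -1 else 1

lemma selectionMatrix_eq_or {ι X Y : Type*} (e : ι → X × Y) (f : ι → Bool) (x : X) (y : Y) :
    selectionMatrix e f x y = 1 ∨ selectionMatrix e f x y = -1 := by
  unfold selectionMatrix
  split_ifs <;> simp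

lemma selectionMatrix_apply {ι X Y : Type*} (e : ι → X × Y) (he : Function.Injective e)
    (f : ι → Bool) (q : ι) :
    selectionMatrix e f (e q).1 (e q).2 = if f q = true then -1 else 1 := by
  have : (∃ q', e q' = ((e q).1, (e q).2) ∧ f q' = true) ↔ f q = true :=
    ⟨fun ⟨q', h, hf⟩ => he h ▸ hf, fun hf => ⟨q, rfl, hf⟩⟩
  simp only [selectionMatrix, this]

/-- Some selection of positions yields a matrix of large sign-rank. -/
lemma exists_signRank_gt {ι : Type*} [Fintype ι] {m r : ℕ} (e : ι → Fin m × Fin m)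
    (he : Function.Injective e)
    (h : (2 * m * r * (Fintype.card ι * 2 + 1) + 1) ^ (2 * m * r) < 2 ^ Fintype.card ι) :
    ∃ f : ι → Bool, r < signRank (selectionMatrix e f) := by
  classical
  by_contra! hcon
  have key := card_le_of_signRank_le (selectionMatrix e)
    (fun f x y => by rcases selectionMatrix_eq_or e f x y with h | h <;> rw [h] <;> norm_num) e
    (fun f g hfg => ?_) r hcon
  · rw [Fintype.card_fun, Fintype.card_bool, Fintype.card_fin,
      show m * r + r * m = 2 * m * r by ring] at key
    exact key.not_gt h
  · obtain ⟨q, hq⟩ := Function.ne_iff.1 hfg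
    refine ⟨q, ?_⟩
    rw [selectionMatrix_apply e he, selectionMatrix_apply e he]
    rcases hf : f q <;> rcases hg : g q <;> simp_all

lemma counting_estimate {m k r : ℕ} {t : ℝ} (hm : 64 ≤ m) (ht : t ^ 3 = m) (ht4 : 4 ≤ t)
    (hk : t / 4 ≤ k) (hkm : k ≤ m) (hr : (r : ℝ) ≤ 1 / 10000 * t / Real.log m) :
    (2 * m * r * (k ^ 4 * 2 + 1) + 1) ^ (2 * m * r) < 2 ^ k ^ 4 := by
  have hm1 : (64 : ℝ) ≤ m := by exact_mod_cast hm
  have hlog : 1 ≤ Real.log m := by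
    rw [Real.le_log_iff_exp_le (by linarith)]
    linarith [Real.exp_one_lt_d9]
  have hrt : (r : ℝ) ≤ t := by
    refine hr.trans ((div_le_iff₀ (by linarith)).2 ?_)
    nlinarith
  have htm : t ≤ m := by
    rw [← ht]; nlinarith [sq_nonneg t]
  have hrm : r ≤ m := by exact_mod_cast hrt.trans htm
  have hbase : 2 * m * r * (k ^ 4 * 2 + 1) + 1 ≤ m ^ 9 := by
    have hm4 : 1 ≤ m ^ 4 := Nat.one_le_pow _ _ (by omega)
    calc 2 * m * r * (k ^ 4 * 2 + 1) + 1 ≤ 2 * m * m * (m ^ 4 * 2 + m ^ 4) + m ^ 6 := by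
          gcongr
          exact Nat.one_le_pow _ _ (by omega)
      _ = 7 * m ^ 6 := by ring
      _ ≤ m ^ 3 * m ^ 6 := by
          gcongr
          calc 7 ≤ 64 ^ 3 := by norm_num
            _ ≤ m ^ 3 := by gcongr
      _ = m ^ 9 := by ring
  refine (Nat.pow_le_pow_left hbase _).trans_lt ?_
  have hreal : ((m : ℝ) ^ 9) ^ (2 * m * r) < 2 ^ k ^ 4 := by
    rw [← Real.log_lt_log_iff (by positivity) (by positivity), Real.log_pow, Real.log_pow,
      Real.log_pow]
    have h1 : (r : ℝ) * Real.log m ≤ 1 / 10000 * t := (le_div_iff₀ (by linarith)).1 hr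
    have h2 : (t / 4) ^ 4 ≤ (k : ℝ) ^ 4 := by gcongr
    have h3 := Real.log_two_gt_d9
    have hm' : (m : ℝ) = t ^ 3 := ht.symm
    push_cast
    calc 2 * (m : ℝ) * r * (9 * Real.log m) = 18 * m * (r * Real.log m) := by ring
      _ ≤ 18 * m * (1 / 10000 * t) := by gcongr
      _ = 18 / 10000 * t ^ 4 := by rw [hm']; ring
      _ < (t / 4) ^ 4 * (69 / 100) := by
        have : 0 < t ^ 4 := by positivity
        nlinarith
      _ ≤ (k : ℝ) ^ 4 * Real.log 2 := by gcongr; linarith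
  exact_mod_cast hreal

/-- There is a constant `c > 0` such that for every sufficiently large `m` there is an
`m × m` sign matrix `A` with `wrect(A)⁻¹ ≤ 2^{15}` (every pair of probability measures on
the rows and columns admits a monochromatic rectangle of weight at least `2^{-15}`), while
`rank_±(A) ≥ c · m^{1/3} / log m`. -/
theorem exists_large_signRank_with_large_rectangles :
    ∃ c : ℝ, 0 < c ∧ ∃ N : ℕ, ∀ m : ℕ, N ≤ m →
      ∃ A : Matrix (Fin m) (Fin m) ℝ,
        (∀ x y, A x y = 1 ∨ A x y = -1) ∧
        (∀ μ₁ μ₂ : Fin m → ℝ,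
          (∀ i, 0 ≤ μ₁ i) → (∑ i, μ₁ i) = 1 → (∀ j, 0 ≤ μ₂ j) → (∑ j, μ₂ j) = 1 →
          ∃ (S T : Finset (Fin m)) (b : ℝ),
            (∀ x ∈ S, ∀ y ∈ T, A x y = b) ∧
            (2 : ℝ) ^ (15 : ℕ) * ((∑ x ∈ S, μ₁ x) * (∑ y ∈ T, μ₂ y)) ≥ 1) ∧
        c * (m : ℝ) ^ ((1 : ℝ) / 3) / Real.log m ≤ (signRank A : ℝ) := by
  refine ⟨1 / 10000, by norm_num, 64, fun m hm => ?_⟩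
  have hm1 : (64 : ℝ) ≤ m := by exact_mod_cast hm
  set t := (m : ℝ) ^ ((1 : ℝ) / 3) with ht
  have ht0 : 0 ≤ t := by positivity
  have ht3 : t ^ 3 = m := by
    rw [ht, ← Real.rpow_natCast, ← Real.rpow_mul (by linarith)]
    norm_num
  have ht4 : 4 ≤ t := by
    by_contra! hlt
    have : t ^ 3 < 4 ^ 3 := by gcongr
    rw [ht3] at this
    linarith
  set k := ⌊t / 2⌋₊ with hk
  have hkle : (k : ℝ) ≤ t / 2 := Nat.floor_le (by linarith)
  have hkge : t / 4 ≤ k := by linarith [Nat.lt_floor_add_one (t / 2)]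
  have hkm : 2 * k ^ 3 ≤ m := by
    have : (2 : ℝ) * k ^ 3 ≤ m := by
      calc (2 : ℝ) * k ^ 3 ≤ 2 * (t / 2) ^ 3 := by gcongr
        _ = t ^ 3 / 4 := by ring
        _ ≤ m := by rw [ht3]; linarith
    exact_mod_cast this
  have hkm' : k ≤ m := (Nat.le_self_pow three_ne_zero k).trans (by omega)
  set r := ⌊1 / 10000 * t / Real.log m⌋₊ with hr
  have hlog : 0 ≤ Real.log m := Real.log_nonneg (by linarith)
  obtain ⟨e, he, hinc⟩ := exists_incidences k m hkm
  have hrle : (r : ℝ) ≤ 1 / 10000 * t / Real.log m := Nat.floor_le (by positivity)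
  have hcard : Fintype.card (Fin (k ^ 3) × Fin k) = k ^ 4 := by
    rw [Fintype.card_prod, Fintype.card_fin, Fintype.card_fin]
    ring
  obtain ⟨f, hf⟩ := exists_signRank_gt (r := r) e he
    (by rw [hcard]; exact counting_estimate hm ht3 ht4 hkge hkm' hrle)
  refine ⟨selectionMatrix e f, selectionMatrix_eq_or e f, fun μ₁ μ₂ h1 h1' h2 h2' => ?_, ?_⟩
  · have hone : ∀ x y : Fin m, (gridPoint k x).2 ≠
        (gridPoint k y).1 * (gridPoint k x).1 + (gridPoint k y).2 →
        selectionMatrix e f x y = 1 := by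
      intro x y hxy
      refine if_neg ?_
      rintro ⟨q, hq, -⟩
      have := hinc q
      rw [hq] at this
      exact hxy this
    obtain ⟨S, T, b, hST, hw⟩ := exists_rectangle_of_incidence (selectionMatrix e f)
      (fun i => gridPoint k i) (fun j => gridPoint k j)
      ((gridPoint_injective k).comp Fin.val_injective)
      ((gridPoint_injective k).comp Fin.val_injective) (selectionMatrix_eq_or e f) hone
      μ₁ μ₂ h1 h1' h2 h2'
    exact ⟨S, T, b, hST, by norm_num; linarith⟩
  · exact (Nat.lt_floor_add_one _).le.trans (by exact_mod_cast hf)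
end

section
/- For every n ≥ 1 and all subsets S, T ⊆ 𝔽₂ⁿ such that ⟨x, y⟩ = 0 (mod 2) for every x ∈ S and y ∈ T, one has |S|·|T| ≤ 2ⁿ. Consequently, every 0-monochromatic rectangle of the inner product matrix IP_n(x,y) = Σ_i x_i y_i mod 2 has size at most 2ⁿ. -/
open scoped BigOperators

/-- The inner product matrix `IP_n` over `𝔽₂ⁿ`, with Boolean entries in `{0,1} ⊆ ℝ`. -/
noncomputable def IP (n : ℕ) : Matrix (Fin n → ZMod 2) (Fin n → ZMod 2) ℝ :=
  Matrix.of fun x y => if (∑ i, x i * y i) = 0 then 0 else 1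

open Module in
/-- Two mutually orthogonal subspaces of `Fⁿ` have total dimension at most `n`. -/
theorem finrank_add_finrank_le_of_dotProduct_eq_zero {F ι : Type*} [Field F] [Fintype ι]
    (V W : Submodule F (ι → F)) (h : ∀ x ∈ V, ∀ y ∈ W, x ⬝ᵥ y = 0) :
    finrank F V + finrank F W ≤ Fintype.card ι := by
  classical
  have hle : W.map (dotProductEquiv F ι).toLinearMap ≤ V.dualAnnihilator := by
    rintro _ ⟨y, hy, rfl⟩
    rw [Submodule.mem_dualAnnihilator]
    intro x hx
    simpa [dotProduct_comm] using h x hx y hy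
  have hfin := Submodule.finrank_mono hle
  rw [LinearEquiv.finrank_map_eq] at hfin
  have hsum := Subspace.finrank_add_finrank_dualAnnihilator_eq V
  rw [finrank_fintype_fun_eq_card] at hsum
  omega

open Module in
/-- Mutually orthogonal subsets `S`, `T` of `Fⁿ` over a finite field `F` satisfy
`|S| * |T| ≤ |F| ^ n`. -/
theorem card_mul_card_le_of_dotProduct_eq_zero {F ι : Type*} [Field F] [Fintype F] [Fintype ι]
    (S T : Finset (ι → F)) (h : ∀ x ∈ S, ∀ y ∈ T, x ⬝ᵥ y = 0) :
    S.card * T.card ≤ Fintype.card F ^ Fintype.card ι := by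
  have hspan : ∀ x ∈ Submodule.span F (S : Set (ι → F)),
      ∀ y ∈ Submodule.span F (T : Set (ι → F)), x ⬝ᵥ y = 0 := by
    intro x hx y hy
    induction hx, hy using Submodule.span_induction₂ with
    | mem_mem x y hx hy => exact h x hx y hy
    | zero_left => simp
    | zero_right => simp
    | add_left x y z _ _ _ hx hy => rw [add_dotProduct, hx, hy, add_zero]
    | add_right x y z _ _ _ hx hy => rw [dotProduct_add, hx, hy, add_zero]
    | smul_left r x y _ _ hxy => rw [smul_dotProduct, hxy, smul_zero]
    | smul_right r x y _ _ hxy => rw [dotProduct_smul, hxy, smul_zero]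
  have hcard (U : Finset (ι → F)) :
      U.card ≤ Fintype.card F ^ finrank F (Submodule.span F (U : Set (ι → F))) := by
    rw [← Nat.card_eq_fintype_card, ← Module.natCard_eq_pow_finrank, ← Nat.card_eq_finsetCard]
    exact Nat.card_mono (Set.toFinite _) Submodule.subset_span
  calc S.card * T.card
      ≤ _ := Nat.mul_le_mul (hcard S) (hcard T)
    _ = _ := (pow_add _ _ _).symm
    _ ≤ _ := Nat.pow_le_pow_right Fintype.card_pos
      (finrank_add_finrank_le_of_dotProduct_eq_zero _ _ hspan)

/-- If `S, T ⊆ 𝔽₂ⁿ` satisfy `⟨x, y⟩ = 0` for all `x ∈ S`, `y ∈ T`, then `|S|·|T| ≤ 2ⁿ`;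
consequently every 0-monochromatic rectangle of the inner product matrix `IP_n` has
size at most `2ⁿ`. -/
theorem orthogonal_rectangle_bound (n : ℕ) (hn : 1 ≤ n) :
    (∀ S T : Finset (Fin n → ZMod 2),
      (∀ x ∈ S, ∀ y ∈ T, (∑ i, x i * y i) = 0) → S.card * T.card ≤ 2 ^ n) ∧
    (∀ S T : Finset (Fin n → ZMod 2),
      (∀ x ∈ S, ∀ y ∈ T, IP n x y = 0) → S.card * T.card ≤ 2 ^ n) := by
  have bound (S T : Finset (Fin n → ZMod 2))
      (h : ∀ x ∈ S, ∀ y ∈ T, (∑ i, x i * y i) = 0) : S.card * T.card ≤ 2 ^ n := by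
    simpa [ZMod.card] using card_mul_card_le_of_dotProduct_eq_zero S T h
  refine ⟨bound, fun S T h => bound S T fun x hx y hy => ?_⟩
  simpa [IP] using h x hx y hy
end
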